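/- Let M be a finite labeled MDP, u a state, and Φ = ⟨φ_1,…,φ_k⟩ a tuple of ω-regular properties over the labeling alphabet. Then the achievable set U_{M_u,Φ} = {r ∈ [0,1]^k : ∃ strategy σ with Pr^σ_u(φ_i) ≥ r_i for all i} is a closed convex polytope in [0,1]^k, downward closed within the nonnegative orthant; in particular its Pareto curve is a convex polyhedral surface. -/

import Mathlib

open scoped BigOperators
open MeasureTheory

/-- A finite-state Markov decision process: a finite set of states `V`, a finite
action alphabet `A`, a nonempty set of enabled actions at each state, and for each
state and enabled action a probability distribution on next states. -/
structure MDP (V A : Type) [Fintype V] [Fintype A] where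
  enabled : V → Finset A
  enabled_nonempty : ∀ v, (enabled v).Nonempty
  p : V → A → V → ℝ
  p_nonneg : ∀ v a v', 0 ≤ p v a v'
  p_sum : ∀ v, ∀ a ∈ enabled v, ∑ v', p v a v' = 1

namespace MDP

variable {V A : Type} [Fintype V] [Fintype A]

/-- A (history-dependent, randomized) strategy: given the list of past
(state, action) pairs (most recent first) and the current state, a probability
distribution on actions, supported on the enabled actions. -/
structure Strategy (M : MDP V A) where
  act : List (V × A) → V → A → ℝ
  act_nonneg : ∀ h v a, 0 ≤ act h v a
  act_support : ∀ h v a, a ∉ M.enabled v → act h v a = 0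
  act_sum : ∀ h v, ∑ a, act h v a = 1

/-- A strategy is memoryless (stationary) if it depends only on the current state. -/
def Strategy.Memoryless {M : MDP V A} (σ : M.Strategy) : Prop :=
  ∀ h h' v, σ.act h v = σ.act h' v

/-- A strategy is pure (deterministic) if it always plays a single action with
probability 1. -/
def Strategy.Pure {M : MDP V A} (σ : M.Strategy) : Prop :=
  ∀ h v, ∃ a, σ.act h v a = 1

/-- `α` is a probability distribution on `V`. -/
def IsDist (α : V → ℝ) : Prop :=
  (∀ v, 0 ≤ α v) ∧ ∑ v, α v = 1

/-- The point (Dirac) distribution at `u`. -/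
def diracD [DecidableEq V] (u : V) : V → ℝ := fun v => if v = u then 1 else 0

/-- The `m`-th binary digit of `x`. -/
noncomputable def bit (m : ℕ) (x : ℝ) : ℝ :=
  if ⌊x * 2 ^ (m + 1)⌋ % 2 = 1 then 1 else 0

/-- Extracts from a single seed `x ∈ [0,1]` a sequence of independent uniform
`[0,1]` samples, by splitting the binary digits of `x`. -/
noncomputable def unif (k : ℕ) (x : ℝ) : ℝ :=
  ∑' n : ℕ, bit (Nat.pair k n) x / 2 ^ (n + 1)

/-- Inverse-CDF sampling from a distribution `q` on a finite type, using the
uniform sample `u`. -/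
noncomputable def sample {S : Type} [Fintype S] [Nonempty S] (q : S → ℝ) (u : ℝ) : S :=
  let e := Fintype.equivFin S
  if h : (Finset.univ.filter fun i => u < ∑ j ∈ Finset.Iic i, q (e.symm j)).Nonempty then
    e.symm ((Finset.univ.filter fun i => u < ∑ j ∈ Finset.Iic i, q (e.symm j)).min' h)
  else Classical.arbitrary S

variable [Nonempty V] [Nonempty A]

/-- The random run of `M` under strategy `σ` from initial distribution `α`, driven by
the random seed `x`: at time `n` it returns the list of past (state, action) pairs
(most recent first) together with the current state and the action chosen there. -/
noncomputable def run (M : MDP V A) (σ : M.Strategy) (α : V → ℝ) (x : ℝ) :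
    ℕ → List (V × A) × (V × A)
  | 0 =>
      let s := sample α (unif 0 x)
      ([], (s, sample (σ.act [] s) (unif 1 x)))
  | n + 1 =>
      let r := run M σ α x n
      let s' := sample (M.p r.2.1 r.2.2) (unif (2 * n + 2) x)
      (r.2 :: r.1, (s', sample (σ.act (r.2 :: r.1) s') (unif (2 * n + 3) x)))

/-- The state at time `n` of the run driven by seed `x`. -/
noncomputable def stateAt (M : MDP V A) (σ : M.Strategy) (α : V → ℝ) (x : ℝ) (n : ℕ) : V :=
  (M.run σ α x n).2.1

/-- The probability, under strategy `σ` from initial distribution `α`, that the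
infinite trajectory of states belongs to the event `E`. -/
noncomputable def PrEvent (M : MDP V A) (σ : M.Strategy) (α : V → ℝ) (E : Set (ℕ → V)) : ℝ :=
  (volume {x : ℝ | x ∈ Set.Icc (0 : ℝ) 1 ∧ M.stateAt σ α x ∈ E}).toReal

/-- The probability of eventually visiting the set `F` (the event `◇F`). -/
noncomputable def PrReach (M : MDP V A) (σ : M.Strategy) (α : V → ℝ) (F : Set V) : ℝ :=
  M.PrEvent σ α {w | ∃ n, w n ∈ F}

/-- A state is absorbing if it has a single enabled action, which loops on it with
probability 1. -/
def Absorbing (M : MDP V A) (v : V) : Prop :=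
  ∃ a, M.enabled v = {a} ∧ M.p v a v = 1

/-- One positive-probability step of the underlying graph of the MDP. -/
def Step (M : MDP V A) (v v' : V) : Prop :=
  ∃ a ∈ M.enabled v, 0 < M.p v a v'

/-- The MDP is cleaned-up w.r.t. `F`: from every state there is a path of
positive-probability transitions reaching `F`. -/
def CleanedUp (M : MDP V A) (F : Set V) : Prop :=
  ∀ v, ∃ w ∈ F, Relation.ReflTransGen M.Step v w

end MDP

/-- A nondeterministic Büchi automaton over the alphabet `S`, with states
`Fin (n + 1)`. -/
structure NBA (S : Type) where
  n : ℕ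
  start : Finset (Fin (n + 1))
  trans : Fin (n + 1) → S → Fin (n + 1) → Prop
  accept : Finset (Fin (n + 1))

/-- The ω-language accepted by a Büchi automaton: the infinite words admitting a run
that starts in an initial state, respects the transition relation, and visits an
accepting state infinitely often. -/
def NBA.lang {S : Type} (B : NBA S) : Set (ℕ → S) :=
  {w | ∃ ρ : ℕ → Fin (B.n + 1), ρ 0 ∈ B.start ∧
    (∀ i, B.trans (ρ i) (w i) (ρ (i + 1))) ∧
    ∀ N : ℕ, ∃ m : ℕ, N ≤ m ∧ ρ m ∈ B.accept}

/-- An ω-language over `S` is ω-regular if it is accepted by some (nondeterministic)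
Büchi automaton. -/
def IsOmegaRegular {S : Type} (L : Set (ℕ → S)) : Prop :=
  ∃ B : NBA S, B.lang = L

namespace MDP

variable {V A : Type} [Fintype V] [Fintype A] [Nonempty V] [Nonempty A]

/-- The probability, under strategy `σ` from initial state `u` of the MDP labeled by
`ℓ`, that the sequence of labels of the trajectory belongs to the ω-language `L`. -/
noncomputable def PrOmega [DecidableEq V] {S : Type} (M : MDP V A) (σ : M.Strategy)
    (u : V) (ℓ : V → S) (L : Set (ℕ → S)) : ℝ :=
  M.PrEvent σ (diracD u) {w | (fun n => ℓ (w n)) ∈ L}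

end MDP

namespace MDP

/-- The achievable set `U_{M_u,Φ}` for the ω-regular properties `L_1, …, L_k`. -/
noncomputable def achOmega {V A : Type} [Fintype V] [Fintype A] [Nonempty V]
    [Nonempty A] [DecidableEq V] {S : Type} (M : MDP V A) (ℓ : V → S) (u : V)
    {k : ℕ} (L : Fin k → Set (ℕ → S)) : Set (Fin k → ℝ) :=
  {r | (∀ i, 0 ≤ r i ∧ r i ≤ 1) ∧
    ∃ σ : M.Strategy, ∀ i, r i ≤ M.PrOmega σ u ℓ (L i)}

end MDP

/-! ### Cylinder sets of infinite sequences -/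

namespace Cyl

variable {E : Type}

/-- The initial segment of length `n` of a sequence, most recent entry first. -/
def pre (ω : ℕ → E) : ℕ → List E
  | 0 => []
  | n + 1 => ω n :: pre ω n

@[simp] lemma length_pre (ω : ℕ → E) (n : ℕ) : (pre ω n).length = n := by
  induction n with
  | zero => rfl
  | succ n ih => simp [pre, ih]

lemma pre_eq_of_le {ω ω' : ℕ → E} {m n : ℕ} (hmn : m ≤ n) (h : pre ω n = pre ω' n) :
    pre ω m = pre ω' m := by
  induction n, hmn using Nat.le_induction with
  | base => exact h
  | succ n _ ih => exact ih (by simp only [pre, List.cons.injEq] at h; exact h.2)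

/-- The set of sequences whose initial segment of length `l.length` is `l`. -/
def cylSet (l : List E) : Set (ℕ → E) := {ω | pre ω l.length = l}

/-- `C` only depends on the first `n` entries. -/
def IsCylAt (n : ℕ) (C : Set (ℕ → E)) : Prop :=
  ∀ ω ω', pre ω n = pre ω' n → ω ∈ C → ω' ∈ C

lemma IsCylAt.mono {m n : ℕ} (hmn : m ≤ n) {C : Set (ℕ → E)} (h : IsCylAt m C) : IsCylAt n C :=
  fun ω ω' hw => h ω ω' (pre_eq_of_le hmn hw)

lemma IsCylAt.union {n : ℕ} {C D : Set (ℕ → E)} (h : IsCylAt n C) (h' : IsCylAt n D) :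
    IsCylAt n (C ∪ D) := fun ω ω' hw => Or.imp (h ω ω' hw) (h' ω ω' hw)

lemma IsCylAt.compl {n : ℕ} {C : Set (ℕ → E)} (h : IsCylAt n C) : IsCylAt n Cᶜ :=
  fun ω ω' hw hC hC' => hC (h ω' ω hw.symm hC')

lemma IsCylAt.diff {n : ℕ} {C D : Set (ℕ → E)} (h : IsCylAt n C) (h' : IsCylAt n D) :
    IsCylAt n (C \ D) := fun ω ω' hw hC => ⟨h ω ω' hw hC.1, h'.compl ω ω' hw hC.2⟩

lemma isCylAt_cylSet (l : List E) : IsCylAt l.length (cylSet l) := by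
  intro ω ω' h hw
  simp only [cylSet, Set.mem_ofPred_eq] at *
  rw [← h, hw]

variable [Finite E] [MeasurableSpace E] [DiscreteMeasurableSpace E]

lemma measurableSet_cylSet (l : List E) : MeasurableSet (cylSet l) := by
  induction l with
  | nil => simp [cylSet, pre]
  | cons e l ih =>
    have : cylSet (e :: l) = (fun ω : ℕ → E => ω l.length) ⁻¹' {e} ∩ cylSet l := by
      ext ω; simp [cylSet, pre]
    rw [this]
    exact ((measurable_pi_apply _) (MeasurableSet.of_discrete)).inter ih

lemma IsCylAt.eq_biUnion {n : ℕ} {C : Set (ℕ → E)} (h : IsCylAt n C) :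
    C = ⋃ l ∈ {l : List E | ∃ ω ∈ C, pre ω n = l}, cylSet l := by
  ext ω
  simp only [Set.mem_iUnion, exists_prop, Set.mem_ofPred_eq]
  constructor
  · intro hw
    exact ⟨pre ω n, ⟨ω, hw, rfl⟩, by simp [cylSet]⟩
  · rintro ⟨l, ⟨ω', hw', rfl⟩, hw⟩
    exact h ω' ω (by simpa [cylSet, eq_comm] using hw) hw'

lemma IsCylAt.measurableSet {n : ℕ} {C : Set (ℕ → E)} (h : IsCylAt n C) : MeasurableSet C := by
  rw [h.eq_biUnion]
  exact MeasurableSet.biUnion (Set.to_countable _) fun l _ => measurableSet_cylSet l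

lemma generateFrom_cylSet :
    (MeasurableSpace.pi : MeasurableSpace (ℕ → E)) =
      MeasurableSpace.generateFrom (Set.range cylSet) := by
  apply le_antisymm
  · refine iSup_le fun n => ?_
    rintro _ ⟨s, -, rfl⟩
    have : IsCylAt (n + 1) ((fun ω : ℕ → E => ω n) ⁻¹' s) := by
      intro ω ω' h hw
      simp only [pre, List.cons.injEq] at h
      simpa [← h.1] using hw
    rw [this.eq_biUnion]
    exact @MeasurableSet.biUnion _ _ (MeasurableSpace.generateFrom _) _ _ (Set.to_countable _)
      fun l _ => MeasurableSpace.measurableSet_generateFrom ⟨l, rfl⟩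
  · apply MeasurableSpace.generateFrom_le
    rintro _ ⟨l, rfl⟩
    exact measurableSet_cylSet l

lemma isPiSystem_cylSet : IsPiSystem (Set.range (cylSet (E := E))) := by
  have key : ∀ l l' : List E, l.length ≤ l'.length → (cylSet l ∩ cylSet l').Nonempty →
      cylSet l ∩ cylSet l' = cylSet l' := by
    rintro l l' hl ⟨ω, h1, h2⟩
    refine Set.inter_eq_right.2 fun ω' h3 => ?_
    refine isCylAt_cylSet l ω ω' (pre_eq_of_le hl ?_) h1
    exact h2.trans h3.symm
  rintro _ ⟨l, rfl⟩ _ ⟨l', rfl⟩ h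
  rcases le_total l.length l'.length with hl | hl
  · exact ⟨l', (key l l' hl h).symm⟩
  · rw [Set.inter_comm] at h ⊢
    exact ⟨l, (key l' l hl h).symm⟩

/-- A finite measure on sequences is determined by its values on cylinder sets. -/
lemma measure_ext {μ ν : Measure (ℕ → E)} [IsFiniteMeasure μ]
    (h : ∀ l, μ (cylSet l) = ν (cylSet l)) : μ = ν := by
  refine ext_of_generate_finite _ generateFrom_cylSet isPiSystem_cylSet ?_ ?_
  · rintro _ ⟨l, rfl⟩
    exact h l
  · simpa [cylSet, pre] using h []

/-- Measurable sets of sequences are approximated by finite-horizon sets. -/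
lemma exists_isCylAt_approx (μ : Measure (ℕ → E)) [IsFiniteMeasure μ] {s : Set (ℕ → E)}
    (hs : MeasurableSet s) {ε : ℝ} (hε : 0 < ε) :
    ∃ n C, IsCylAt n C ∧ μ.real (symmDiff C s) < ε := by
  have hring : IsSetRing {C : Set (ℕ → E) | ∃ n, IsCylAt n C} := by
    refine ⟨⟨0, fun _ _ _ h => h⟩, ?_, ?_⟩
    · rintro C D ⟨n, hC⟩ ⟨m, hD⟩
      exact ⟨max n m, (hC.mono (le_max_left _ _)).union (hD.mono (le_max_right _ _))⟩
    · rintro C D ⟨n, hC⟩ ⟨m, hD⟩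
      exact ⟨max n m, (hC.mono (le_max_left _ _)).diff (hD.mono (le_max_right _ _))⟩
  have hgen : (MeasurableSpace.pi : MeasurableSpace (ℕ → E)) =
      MeasurableSpace.generateFrom {C : Set (ℕ → E) | ∃ n, IsCylAt n C} := by
    apply le_antisymm
    · rw [generateFrom_cylSet]
      apply MeasurableSpace.generateFrom_mono
      rintro _ ⟨l, rfl⟩
      exact ⟨_, isCylAt_cylSet l⟩
    · apply MeasurableSpace.generateFrom_le
      rintro C ⟨n, hC⟩
      exact hC.measurableSet
  obtain ⟨C, ⟨n, hC⟩, h⟩ := exists_measure_symmDiff_lt_of_generateFrom_isSetRing (μ := μ) hring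
    ⟨{Set.univ}, Set.countable_singleton _, by
      rintro _ rfl; exact ⟨0, fun _ _ _ _ => trivial⟩, by simp⟩ hgen hs
    (ε := ENNReal.ofReal ε) (by simpa using hε)
  exact ⟨n, C, hC, by
    rw [Measure.real]
    exact (ENNReal.lt_ofReal_iff_toReal_lt (measure_ne_top _ _)).1 h⟩

end Cyl

namespace Cyl

lemma pre_eq_pre_iff {E : Type} {ω ω' : ℕ → E} {n : ℕ} :
    pre ω n = pre ω' n ↔ ∀ i < n, ω i = ω' i := by
  induction n with
  | zero => simp [pre]
  | succ n ih =>
    simp only [pre, List.cons.injEq, ih]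
    constructor
    · rintro ⟨h1, h2⟩ i hi
      rcases Nat.lt_succ_iff_lt_or_eq.1 hi with h | rfl
      exacts [h2 i h, h1]
    · exact fun h => ⟨h n n.lt_succ_self, fun i hi => h i (hi.trans n.lt_succ_self)⟩

lemma exists_pre_eq {E : Type} [Nonempty E] (l : List E) : ∃ ω : ℕ → E, pre ω l.length = l := by
  induction l with
  | nil => exact ⟨fun _ => Classical.arbitrary E, rfl⟩
  | cons e l ih =>
    obtain ⟨ω, h⟩ := ih
    refine ⟨Function.update ω l.length e, ?_⟩
    have : pre (Function.update ω l.length e) l.length = pre ω l.length :=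
      pre_eq_pre_iff.2 fun i hi => by simp [hi.ne]
    simp [pre, this, h]

end Cyl

/-! ### Independence of the seeds -/

namespace MDP

open Cyl

/-- The uniform measure on the unit interval, as a measure on `ℝ`. -/
noncomputable def unitMeasure : Measure ℝ := volume.restrict (Set.Icc 0 1)

instance : IsProbabilityMeasure unitMeasure := ⟨by simp [unitMeasure]⟩

lemma unitMeasure_apply {s : Set ℝ} (hs : MeasurableSet s) :
    unitMeasure s = volume (s ∩ Set.Icc 0 1) := Measure.restrict_apply hs

/-- The fair coin. -/
noncomputable def coin : Measure Bool := (PMF.uniformOfFintype Bool).toMeasure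

instance : IsProbabilityMeasure coin := by unfold coin; infer_instance

lemma coin_singleton (b : Bool) : coin {b} = 2⁻¹ := by
  simp [coin]

/-- The sequence of binary digits, as Booleans. -/
noncomputable def bits (x : ℝ) (m : ℕ) : Bool := decide (⌊x * 2 ^ (m + 1)⌋ % 2 = 1)

lemma bit_eq (m : ℕ) (x : ℝ) : bit m x = if bits x m then 1 else 0 := by
  simp [bit, bits]

lemma measurable_bits : Measurable bits := by
  refine measurable_pi_lambda _ fun m => ?_
  have h : Measurable fun x : ℝ => ⌊x * 2 ^ (m + 1)⌋ := Int.measurable_floor.comp (by fun_prop)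
  exact (measurable_of_countable (fun z : ℤ => decide (z % 2 = 1))).comp h

lemma floor_succ (x : ℝ) (n : ℕ) :
    ⌊x * 2 ^ (n + 1)⌋ = 2 * ⌊x * 2 ^ n⌋ + if bits x n then 1 else 0 := by
  have h1 := Int.floor_le (x * 2 ^ n)
  have h2 := Int.lt_floor_add_one (x * 2 ^ n)
  have h3 := Int.floor_le (x * 2 ^ (n + 1))
  have h4 := Int.lt_floor_add_one (x * 2 ^ (n + 1))
  have e : x * 2 ^ (n + 1) = 2 * (x * 2 ^ n) := by ring
  have h5 : 2 * ⌊x * 2 ^ n⌋ < ⌊x * 2 ^ (n + 1)⌋ + 1 := by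
    have : ((2 * ⌊x * 2 ^ n⌋ : ℤ) : ℝ) < ((⌊x * 2 ^ (n + 1)⌋ + 1 : ℤ) : ℝ) := by
      push_cast; linarith
    exact_mod_cast this
  have h6 : ⌊x * 2 ^ (n + 1)⌋ < 2 * ⌊x * 2 ^ n⌋ + 2 := by
    have : ((⌊x * 2 ^ (n + 1)⌋ : ℤ) : ℝ) < ((2 * ⌊x * 2 ^ n⌋ + 2 : ℤ) : ℝ) := by
      push_cast; linarith
    exact_mod_cast this
  have hb : bits x n = decide (⌊x * 2 ^ (n + 1)⌋ % 2 = 1) := rfl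
  rw [hb]
  simp only [decide_eq_true_eq]
  split_ifs <;> omega

/-- The integer with the given binary digits, least significant first. -/
def ofBits : List Bool → ℤ
  | [] => 0
  | b :: l => 2 * ofBits l + if b then 1 else 0

lemma ofBits_nonneg (l : List Bool) : 0 ≤ ofBits l := by
  induction l with
  | nil => simp [ofBits]
  | cons b l ih => simp only [ofBits]; split_ifs <;> omega

lemma ofBits_lt (l : List Bool) : ofBits l + 1 ≤ 2 ^ l.length := by
  induction l with
  | nil => simp [ofBits]
  | cons b l ih =>
    simp only [ofBits, List.length_cons, pow_succ]; split_ifs <;> omega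

lemma pre_bits_iff {x : ℝ} (hx : x ∈ Set.Ico (0 : ℝ) 1) (l : List Bool) :
    pre (bits x) l.length = l ↔ ⌊x * 2 ^ l.length⌋ = ofBits l := by
  induction l with
  | nil =>
    have : ⌊x⌋ = 0 := Int.floor_eq_zero_iff.2 hx
    simp [pre, ofBits, this]
  | cons b l ih =>
    simp only [pre, List.length_cons, List.cons.injEq, ih, ofBits, floor_succ]
    constructor
    · rintro ⟨rfl, h⟩; rw [h]
    · intro h
      cases hb : bits x l.length <;> cases b <;> simp [hb] at h ⊢ <;> omega

lemma map_bits : unitMeasure.map bits = Measure.infinitePi fun _ : ℕ => coin := by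
  have : IsProbabilityMeasure (unitMeasure.map bits) :=
    Measure.isProbabilityMeasure_map measurable_bits.aemeasurable
  refine measure_ext fun l => ?_
  have h1 : unitMeasure.map bits (cylSet l) = 2⁻¹ ^ l.length := by
    rw [Measure.map_apply measurable_bits (measurableSet_cylSet l), unitMeasure,
      Measure.restrict_congr_set Ico_ae_eq_Icc.symm,
      Measure.restrict_apply (measurable_bits (measurableSet_cylSet l))]
    have : bits ⁻¹' cylSet l ∩ Set.Ico 0 1 =
        Set.Ico ((ofBits l : ℝ) / 2 ^ l.length) ((ofBits l + 1) / 2 ^ l.length) := by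
      ext x
      simp only [Set.mem_inter_iff, Set.mem_preimage, cylSet, Set.mem_ofPred_eq, Set.mem_Ico]
      have hp : (0 : ℝ) < 2 ^ l.length := by positivity
      have e : ((ofBits l : ℝ) / 2 ^ l.length ≤ x ∧ x < (ofBits l + 1) / 2 ^ l.length) ↔
          ⌊x * 2 ^ l.length⌋ = ofBits l := by
        rw [Int.floor_eq_iff, div_le_iff₀ hp, lt_div_iff₀ hp]
      rw [e]
      constructor
      · rintro ⟨h, hx⟩
        exact (pre_bits_iff hx l).1 h
      · intro h
        have hx : x ∈ Set.Ico (0 : ℝ) 1 := by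
          obtain ⟨h1, h2⟩ := e.2 h
          have h3 : (0 : ℝ) ≤ ofBits l := by exact_mod_cast ofBits_nonneg l
          have h4 : (ofBits l : ℝ) + 1 ≤ 2 ^ l.length := by exact_mod_cast ofBits_lt l
          exact ⟨le_trans (by positivity) h1, h2.trans_le ((div_le_one hp).2 h4)⟩
        exact ⟨(pre_bits_iff hx l).2 h, hx⟩
    rw [this, Real.volume_Ico, ← sub_div, add_sub_cancel_left, one_div, ← inv_pow,
      ENNReal.ofReal_pow (by positivity), ENNReal.ofReal_inv_of_pos (by norm_num)]
    simp
  obtain ⟨ω, hω⟩ := exists_pre_eq l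
  have h2 : cylSet l = Set.pi (Finset.range l.length) fun i => {ω i} := by
    ext ω'
    rw [cylSet, Set.mem_ofPred_eq]
    nth_rw 2 [← hω]
    rw [pre_eq_pre_iff]
    simp [Set.mem_pi]
  rw [h1, h2, Measure.infinitePi_pi _ fun _ _ => MeasurableSet.of_discrete]
  simp [coin_singleton]

/-- The real number with the given binary expansion. -/
noncomputable def ofDigits (b : ℕ → Bool) : ℝ := ∑' n, (if b n then (1 : ℝ) else 0) / 2 ^ (n + 1)

lemma summable_digits (b : ℕ → Bool) :
    Summable fun n => (if b n then (1 : ℝ) else 0) / 2 ^ (n + 1) := by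
  refine Summable.of_nonneg_of_le (fun n => by positivity) (fun n => ?_) (summable_geometric_two' 1)
    (g := fun n => (if b n then (1 : ℝ) else 0) / 2 ^ (n + 1)) (f := fun n => 1 / 2 / 2 ^ n)
  rw [pow_succ, div_div, mul_comm]
  gcongr
  split_ifs <;> norm_num

lemma measurable_ofDigits : Measurable ofDigits := by
  refine measurable_of_tendsto_metrizable
    (f := fun N b => ∑ n ∈ Finset.range N, (if b n then (1 : ℝ) else 0) / 2 ^ (n + 1)) ?_ ?_
  · intro N
    refine Finset.measurable_sum _ fun n _ => ?_
    exact (measurable_of_countable (fun c : Bool => (if c then (1 : ℝ) else 0) / 2 ^ (n + 1))).comp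
      (measurable_pi_apply n)
  · rw [tendsto_pi_nhds]
    exact fun b => (summable_digits b).hasSum.tendsto_sum_nat

lemma ofDigits_bits {x : ℝ} (hx : x ∈ Set.Ico (0 : ℝ) 1) : ofDigits (bits x) = x := by
  have h1 := (summable_digits (bits x)).hasSum.tendsto_sum_nat
  have h2 : ∀ N, ∑ n ∈ Finset.range N, (if bits x n then (1 : ℝ) else 0) / 2 ^ (n + 1) =
      ⌊x * 2 ^ N⌋ / 2 ^ N := by
    intro N
    induction N with
    | zero => simp [Int.floor_eq_zero_iff.2 hx]
    | succ N ih =>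
      rw [Finset.sum_range_succ, ih, floor_succ]
      push_cast
      field_simp
      ring
  refine tendsto_nhds_unique h1 ?_
  simp_rw [h2]
  exact tendsto_nat_floor_mul_div_pow x
where
  tendsto_nat_floor_mul_div_pow (x : ℝ) :
      Filter.Tendsto (fun N : ℕ => (⌊x * 2 ^ N⌋ : ℝ) / 2 ^ N) Filter.atTop (nhds x) := by
    have hz : Filter.Tendsto (fun N : ℕ => (1 / 2 : ℝ) ^ N) Filter.atTop (nhds 0) :=
      tendsto_pow_atTop_nhds_zero_of_lt_one (by norm_num) (by norm_num)
    refine tendsto_of_tendsto_of_tendsto_of_le_of_le (g := fun N : ℕ => x - (1 / 2) ^ N)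
      (h := fun _ => x) (by simpa using hz.const_sub x) tendsto_const_nhds ?_ ?_
    · intro N
      have hp : (0 : ℝ) < 2 ^ N := by positivity
      simp only [one_div, inv_pow]
      rw [le_div_iff₀ hp, sub_mul, inv_mul_cancel₀ hp.ne']
      linarith [Int.lt_floor_add_one (x * 2 ^ N)]
    · intro N
      exact (div_le_iff₀ (by positivity)).2 (Int.floor_le _)

lemma map_ofDigits : (Measure.infinitePi fun _ : ℕ => coin).map ofDigits = unitMeasure := by
  rw [← map_bits, Measure.map_map measurable_ofDigits measurable_bits]
  have : ofDigits ∘ bits =ᵐ[unitMeasure] id := by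
    rw [unitMeasure, Measure.restrict_congr_set Ico_ae_eq_Icc.symm]
    filter_upwards [ae_restrict_mem measurableSet_Ico] with x hx using ofDigits_bits hx
  rw [Measure.map_congr this, Measure.map_id]

/-- The blocks of binary digits selected by the pairing function. -/
noncomputable def blocks (x : ℝ) (k n : ℕ) : Bool := bits x (Nat.pair k n)

lemma measurable_blocks : Measurable blocks :=
  measurable_pi_lambda _ fun k => measurable_pi_lambda _ fun n =>
    (measurable_pi_apply (Nat.pair k n)).comp measurable_bits

lemma map_blocks : unitMeasure.map blocks =
    Measure.infinitePi fun _ : ℕ => Measure.infinitePi fun _ : ℕ => coin := by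
  rw [← Measure.infinitePi_map_curry (fun _ _ => coin)]
  have h := Measure.infinitePi_map_piCongrLeft (fun _ : ℕ × ℕ => coin) Nat.pairEquiv.symm
  rw [← h, ← map_bits, Measure.map_map (by fun_prop) measurable_bits,
    Measure.map_map (by fun_prop) ((MeasurableEquiv.measurable _).comp measurable_bits)]
  congr 1
  ext x k n
  have := (Equiv.piCongrLeft_apply_apply (fun _ : ℕ × ℕ => Bool) Nat.pairEquiv.symm (bits x)
    (Nat.pair k n))
  simpa [MeasurableEquiv.curry, blocks, MeasurableEquiv.piCongrLeft] using this.symm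

lemma unif_eq (k : ℕ) (x : ℝ) : unif k x = ofDigits (blocks x k) := by
  refine tsum_congr fun n => ?_
  rw [bit_eq]
  rfl

lemma measurable_unif (k : ℕ) : Measurable (unif k) := by
  have : unif k = fun x => ofDigits (blocks x k) := funext (unif_eq k)
  rw [this]
  exact measurable_ofDigits.comp ((measurable_pi_apply k).comp measurable_blocks)

/-- The seeds are independent and uniformly distributed. -/
lemma unitMeasure_unif (m : ℕ) {B : ℕ → Set ℝ} (hB : ∀ j, MeasurableSet (B j)) :
    unitMeasure {x | ∀ j < m, unif j x ∈ B j} = ∏ j ∈ Finset.range m, unitMeasure (B j) := by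
  have h : {x | ∀ j < m, unif j x ∈ B j} =
      blocks ⁻¹' Set.pi (Finset.range m) fun j => ofDigits ⁻¹' B j := by
    ext x; simp [unif_eq, Set.mem_pi]
  have hm : ∀ j, MeasurableSet (ofDigits ⁻¹' B j) := fun j => measurable_ofDigits (hB j)
  rw [h, ← Measure.map_apply measurable_blocks
    (MeasurableSet.pi (Finset.countable_toSet _) fun j _ => hm j), map_blocks,
    Measure.infinitePi_pi _ fun j _ => hm j]
  refine Finset.prod_congr rfl fun j _ => ?_
  rw [← Measure.map_apply measurable_ofDigits (hB j), map_ofDigits]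

end MDP

namespace MDP

open Cyl

/-! ### The law of the trajectory -/

lemma measurable_sample {S : Type} [Fintype S] [Nonempty S] [MeasurableSpace S] (q : S → ℝ) :
    Measurable (sample q) := by
  classical
  let e := Fintype.equivFin S
  let c : ℝ → Fin (Fintype.card S) → Prop := fun u i => u < ∑ j ∈ Finset.Iic i, q (e.symm j)
  let g : (Fin (Fintype.card S) → Prop) → S := fun c =>
    if h : (Finset.univ.filter c).Nonempty then e.symm ((Finset.univ.filter c).min' h)
    else Classical.arbitrary S
  have hc : Measurable c := measurable_pi_lambda _ fun i => measurableSet_setOfPred.1 measurableSet_Iio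
  have : sample q = g ∘ c := by
    funext u
    simp only [sample, g, c, Function.comp]
    congr!
  rw [this]
  exact (measurable_of_countable g).comp hc

lemma unitMeasure_sample {S : Type} [Fintype S] [Nonempty S] {q : S → ℝ} (hq : ∀ s, 0 ≤ q s)
    (hq1 : ∑ s, q s = 1) (s : S) :
    unitMeasure {u | sample q u = s} = ENNReal.ofReal (q s) := by
  classical
  let e := Fintype.equivFin S
  obtain ⟨i, rfl⟩ := e.symm.surjective s
  let P : Fin (Fintype.card S) → ℝ := fun i => ∑ j ∈ Finset.Iic i, q (e.symm j)
  let Q : ℝ := ∑ j ∈ Finset.Iio i, q (e.symm j)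
  have hPQ : P i = Q + q (e.symm i) := by
    simp only [P, Q]
    rw [← Finset.Iio_insert, Finset.sum_insert (by simp), add_comm]
  have hQ0 : 0 ≤ Q := Finset.sum_nonneg fun _ _ => hq _
  have hP1 : ∀ i, P i ≤ 1 := fun i => by
    rw [← hq1, ← e.symm.sum_comp]
    exact Finset.sum_le_sum_of_subset_of_nonneg (Finset.subset_univ _) fun _ _ _ => hq _
  have key : {u | sample q u = e.symm i} ∩ Set.Ico 0 1 = Set.Ico Q (P i) := by
    ext u
    simp only [Set.mem_inter_iff, Set.mem_ofPred_eq, Set.mem_Ico]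
    have hne : u < 1 → (Finset.univ.filter fun i => u < P i).Nonempty := by
      intro hu
      have : 0 < Fintype.card S := Fintype.card_pos
      refine ⟨⟨Fintype.card S - 1, by omega⟩, ?_⟩
      simp only [Finset.mem_filter, Finset.mem_univ, true_and, P]
      have : (Finset.Iic (⟨Fintype.card S - 1, by omega⟩ : Fin (Fintype.card S))) =
          Finset.univ := by
        ext j; simp only [Finset.mem_Iic, Finset.mem_univ, iff_true, Fin.le_def]; omega
      rw [this, e.symm.sum_comp, hq1]
      exact hu
    have hmin : ∀ h : (Finset.univ.filter fun i => u < P i).Nonempty,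
        0 ≤ u → ((Finset.univ.filter fun i => u < P i).min' h = i ↔ Q ≤ u ∧ u < P i) := by
      intro h hu0
      rw [Finset.min'_eq_iff]
      simp only [Finset.mem_filter, Finset.mem_univ, true_and]
      constructor
      · rintro ⟨h1, h2⟩
        refine ⟨?_, h1⟩
        by_contra! hlt
        have hn : (Finset.Iio i).Nonempty := by
          by_contra hn
          rw [Finset.not_nonempty_iff_eq_empty] at hn
          simp only [Q, hn, Finset.sum_empty] at hlt
          linarith
        have hi : 0 < i.1 := by
          obtain ⟨j, hj⟩ := hn
          rw [Finset.mem_Iio, Fin.lt_def] at hj; omega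
        let j : Fin (Fintype.card S) := ⟨i.1 - 1, by omega⟩
        have hj : Finset.Iic j = Finset.Iio i := by
          ext t; simp only [Finset.mem_Iic, Finset.mem_Iio, Fin.le_def, Fin.lt_def, j]; omega
        have := h2 j (by simp only [P, hj]; exact hlt)
        rw [Fin.le_def] at this
        simp only [j] at this
        omega
      · rintro ⟨h1, h2⟩
        refine ⟨h2, fun j hj => ?_⟩
        by_contra! hlt
        refine absurd hj (not_lt.2 (le_trans ?_ h1))
        exact Finset.sum_le_sum_of_subset_of_nonneg (fun t ht => by
          rw [Finset.mem_Iic] at ht; rw [Finset.mem_Iio]; exact ht.trans_lt hlt) fun _ _ _ => hq _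
    constructor
    · rintro ⟨h, h0, h1⟩
      rw [← hmin (hne h1) h0]
      have := hne h1
      simp only [sample] at h
      rw [dif_pos this] at h
      exact e.symm.injective h
    · rintro ⟨h1, h2⟩
      have hu1 : u < 1 := h2.trans_le (hP1 i)
      have hu0 : 0 ≤ u := hQ0.trans h1
      refine ⟨?_, hu0, hu1⟩
      simp only [sample]
      rw [dif_pos (hne hu1)]
      exact congrArg e.symm ((hmin (hne hu1) hu0).2 ⟨h1, h2⟩)
  let : MeasurableSpace S := ⊤
  have hms : MeasurableSet {u | sample q u = e.symm i} :=
    measurable_sample q (MeasurableSpace.measurableSet_top (s := {e.symm i}))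
  rw [unitMeasure, Measure.restrict_congr_set Ico_ae_eq_Icc.symm, Measure.restrict_apply hms, key,
    Real.volume_Ico, hPQ, add_sub_cancel_left]

variable {V A : Type} [Fintype V] [Fintype A] [DecidableEq V]

/-- The distribution of the next state given the past. -/
noncomputable def stepD (M : MDP V A) (u : V) : List (V × A) → V → ℝ
  | [] => diracD u
  | e :: _ => M.p e.1 e.2

/-- The probability of a finite history. -/
noncomputable def wt (M : MDP V A) (σ : M.Strategy) (u : V) : List (V × A) → ℝ
  | [] => 1
  | e :: l => wt M σ u l * M.stepD u l e.1 * σ.act l e.1 e.2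

lemma stepD_nonneg (M : MDP V A) (u : V) (l : List (V × A)) (v : V) : 0 ≤ M.stepD u l v := by
  cases l with
  | nil => simp only [stepD, diracD]; split_ifs <;> norm_num
  | cons e l => exact M.p_nonneg _ _ _

lemma wt_nonneg (M : MDP V A) (σ : M.Strategy) (u : V) (l : List (V × A)) : 0 ≤ M.wt σ u l := by
  induction l with
  | nil => simp [wt]
  | cons e l ih => exact mul_nonneg (mul_nonneg ih (stepD_nonneg _ _ _ _)) (σ.act_nonneg _ _ _)

variable [Nonempty V] [Nonempty A]

/-- The trajectory of states and actions driven by a seed. -/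
noncomputable def traj (M : MDP V A) (σ : M.Strategy) (u : V) (x : ℝ) (n : ℕ) : V × A :=
  (M.run σ (diracD u) x n).2

lemma pre_traj (M : MDP V A) (σ : M.Strategy) (u : V) (x : ℝ) (n : ℕ) :
    pre (M.traj σ u x) n = (M.run σ (diracD u) x n).1 := by
  induction n with
  | zero => rfl
  | succ n ih => simp only [pre, run, ih]; rfl

lemma traj_eq (M : MDP V A) (σ : M.Strategy) (u : V) (x : ℝ) (n : ℕ) :
    M.traj σ u x n =
      (sample (M.stepD u (pre (M.traj σ u x) n)) (unif (2 * n) x),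
        sample (σ.act (pre (M.traj σ u x) n)
          (sample (M.stepD u (pre (M.traj σ u x) n)) (unif (2 * n) x))) (unif (2 * n + 1) x)) := by
  cases n with
  | zero => rfl
  | succ n =>
    have := pre_traj M σ u x (n + 1)
    rw [this]
    rfl

/-- The constraints on the seeds describing a finite history. -/
def seedSet (M : MDP V A) (σ : M.Strategy) (u : V) : List (V × A) → ℕ → Set ℝ
  | [], _ => Set.univ
  | e :: l, j => if j = 2 * l.length then {y | sample (M.stepD u l) y = e.1} else
      if j = 2 * l.length + 1 then {y | sample (σ.act l e.1) y = e.2} else seedSet M σ u l j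

lemma measurableSet_seedSet (M : MDP V A) (σ : M.Strategy) (u : V) (l : List (V × A)) (j : ℕ) :
    MeasurableSet (M.seedSet σ u l j) := by
  let : MeasurableSpace V := ⊤
  let : MeasurableSpace A := ⊤
  induction l with
  | nil => exact MeasurableSet.univ
  | cons e l ih =>
    simp only [seedSet]
    split_ifs
    · exact measurable_sample _ (MeasurableSpace.measurableSet_top (s := {e.1}))
    · exact measurable_sample _ (MeasurableSpace.measurableSet_top (s := {e.2}))
    · exact ih

lemma pre_traj_eq_iff (M : MDP V A) (σ : M.Strategy) (u : V) (x : ℝ) (l : List (V × A)) :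
    pre (M.traj σ u x) l.length = l ↔ ∀ j < 2 * l.length, unif j x ∈ M.seedSet σ u l j := by
  induction l with
  | nil => simp [pre]
  | cons e l ih =>
    have h1 : (∀ j < 2 * (e :: l).length, unif j x ∈ M.seedSet σ u (e :: l) j) ↔
        sample (M.stepD u l) (unif (2 * l.length) x) = e.1 ∧
        sample (σ.act l e.1) (unif (2 * l.length + 1) x) = e.2 ∧
        ∀ j < 2 * l.length, unif j x ∈ M.seedSet σ u l j := by
      constructor
      · intro h
        refine ⟨?_, ?_, fun j hj => ?_⟩
        · simpa [seedSet] using h (2 * l.length) (by simp)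
        · simpa [seedSet] using h (2 * l.length + 1) (by simp; omega)
        · have := h j (by simp; omega)
          simpa only [seedSet, if_neg (show ¬ j = 2 * l.length by omega),
            if_neg (show ¬ j = 2 * l.length + 1 by omega)] using this
      · rintro ⟨h1, h2, h3⟩ j hj
        simp only [seedSet]
        split_ifs with h h'
        · subst h; exact h1
        · subst h'; exact h2
        · exact h3 j (by simp at hj; omega)
    rw [h1, ← ih]
    simp only [pre, List.length_cons, List.cons.injEq]
    constructor
    · rintro ⟨h, h'⟩
      rw [traj_eq, h'] at h
      have e1 := congrArg Prod.fst h
      have e2 := congrArg Prod.snd h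
      dsimp only at e1 e2
      rw [e1] at e2
      exact ⟨e1, e2, h'⟩
    · rintro ⟨e1, e2, h'⟩
      refine ⟨?_, h'⟩
      rw [traj_eq, h', e1, e2]

lemma prod_seedSet (M : MDP V A) (σ : M.Strategy) (u : V) (l : List (V × A)) :
    ∏ j ∈ Finset.range (2 * l.length), unitMeasure (M.seedSet σ u l j) =
      ENNReal.ofReal (M.wt σ u l) := by
  induction l with
  | nil => simp [wt]
  | cons e l ih =>
    rw [List.length_cons, mul_add, mul_one, Finset.prod_range_succ, Finset.prod_range_succ]
    have h : ∏ j ∈ Finset.range (2 * l.length), unitMeasure (M.seedSet σ u (e :: l) j) =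
        ENNReal.ofReal (M.wt σ u l) := by
      rw [← ih]
      refine Finset.prod_congr rfl fun j hj => ?_
      rw [Finset.mem_range] at hj
      simp only [seedSet]
      rw [if_neg (by omega), if_neg (by omega)]
    rw [h]
    simp only [seedSet, if_true, if_neg (show ¬ 2 * l.length + 1 = 2 * l.length by omega), wt]
    rw [unitMeasure_sample (σ.act_nonneg _ _) (σ.act_sum _ _),
      ENNReal.ofReal_mul (mul_nonneg (wt_nonneg _ _ _ _) (stepD_nonneg _ _ _ _)),
      ENNReal.ofReal_mul (wt_nonneg _ _ _ _)]
    congr 1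
    rcases l with _ | ⟨e', l⟩
    · rw [unitMeasure_sample (stepD_nonneg _ _ _) (by simp [stepD, diracD])]
    · by_cases he : e'.2 ∈ M.enabled e'.1
      · rw [unitMeasure_sample (stepD_nonneg _ _ _) (M.p_sum _ _ he)]
      · simp [wt, σ.act_support _ _ _ he]

variable [MeasurableSpace V] [DiscreteMeasurableSpace V]
  [MeasurableSpace A] [DiscreteMeasurableSpace A]

lemma measurable_traj (M : MDP V A) (σ : M.Strategy) (u : V) : Measurable (M.traj σ u) := by
  have h : ∀ l, MeasurableSet (M.traj σ u ⁻¹' cylSet l) := fun l => by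
    have : M.traj σ u ⁻¹' cylSet l =
        ⋂ j ∈ Finset.range (2 * l.length), unif j ⁻¹' M.seedSet σ u l j := by
      ext x
      simp [cylSet, pre_traj_eq_iff]
    rw [this]
    exact Finset.measurableSet_biInter _ fun j _ =>
      measurable_unif j (measurableSet_seedSet _ _ _ _ _)
  rw [generateFrom_cylSet]
  exact measurable_generateFrom (by rintro _ ⟨l, rfl⟩; exact h l)

/-- The law of the trajectory of states and actions. -/
noncomputable def law (M : MDP V A) (σ : M.Strategy) (u : V) : Measure (ℕ → V × A) :=
  unitMeasure.map (M.traj σ u)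

instance (M : MDP V A) (σ : M.Strategy) (u : V) : IsProbabilityMeasure (M.law σ u) :=
  Measure.isProbabilityMeasure_map (measurable_traj M σ u).aemeasurable

lemma law_cylSet (M : MDP V A) (σ : M.Strategy) (u : V) (l : List (V × A)) :
    M.law σ u (cylSet l) = ENNReal.ofReal (M.wt σ u l) := by
  rw [law, Measure.map_apply (measurable_traj M σ u) (measurableSet_cylSet l)]
  have : M.traj σ u ⁻¹' cylSet l = {x | ∀ j < 2 * l.length, unif j x ∈ M.seedSet σ u l j} := by
    ext x
    simp [cylSet, pre_traj_eq_iff]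
  rw [this, unitMeasure_unif _ fun j => measurableSet_seedSet _ _ _ _ _, prod_seedSet]

lemma law_real_cylSet (M : MDP V A) (σ : M.Strategy) (u : V) (l : List (V × A)) :
    (M.law σ u).real (cylSet l) = M.wt σ u l := by
  rw [Measure.real, law_cylSet, ENNReal.toReal_ofReal (wt_nonneg _ _ _ _)]

lemma PrEvent_eq_law (M : MDP V A) (σ : M.Strategy) (u : V) {E : Set (ℕ → V)}
    (hE : MeasurableSet E) :
    M.PrEvent σ (diracD u) E = (M.law σ u).real {ω | (fun n => (ω n).1) ∈ E} := by
  have hm : MeasurableSet {ω : ℕ → V × A | (fun n => (ω n).1) ∈ E} :=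
    (measurable_pi_lambda _ fun n => measurable_fst.comp (measurable_pi_apply n)) hE
  rw [PrEvent, Measure.real, law, Measure.map_apply (measurable_traj M σ u) hm,
    unitMeasure_apply (measurable_traj M σ u hm)]
  congr 2
  ext x
  exact and_comm

end MDP

namespace Cyl

/-- Prepending an entry to a sequence. -/
def scons {E : Type} (e : E) (ω : ℕ → E) : ℕ → E
  | 0 => e
  | n + 1 => ω n

/-- The set of continuations of the entry `e` to a sequence in `s`. -/
def tl {E : Type} (e : E) (s : Set (ℕ → E)) : Set (ℕ → E) := {ω | scons e ω ∈ s}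

/-- The set of continuations of the history `h` (most recent entry first) to a sequence in `s`. -/
def tls {E : Type} : List E → Set (ℕ → E) → Set (ℕ → E)
  | [], s => s
  | e :: h, s => tl e (tls h s)

lemma pre_scons {E : Type} (e : E) (ω : ℕ → E) (n : ℕ) :
    pre (scons e ω) (n + 1) = pre ω n ++ [e] := by
  induction n with
  | zero => rfl
  | succ n ih => rw [pre, ih]; rfl

lemma IsCylAt.tl {E : Type} {n : ℕ} {C : Set (ℕ → E)} (h : IsCylAt (n + 1) C) (e : E) :
    IsCylAt n (tl e C) := fun ω ω' hw hC => h _ _ (by rw [pre_scons, pre_scons, hw]) hC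

lemma IsCylAt.tls {E : Type} {n : ℕ} (h : List E) {C : Set (ℕ → E)}
    (hC : IsCylAt (n + h.length) C) : IsCylAt n (tls h C) := by
  induction h generalizing n with
  | nil => exact hC
  | cons e h ih => exact (ih (hC.mono (by simp; omega))).tl e

lemma IsCylAt.eq_univ_or_empty {E : Type} {C : Set (ℕ → E)} (hC : IsCylAt 0 C) :
    C = Set.univ ∨ C = ∅ := by
  rcases C.eq_empty_or_nonempty with h | ⟨ω, hω⟩
  · exact Or.inr h
  · exact Or.inl (Set.eq_univ_of_forall fun ω' => hC ω ω' rfl hω)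

lemma IsCylAt.tls_eq {E : Type} {n : ℕ} {h : List E} {C : Set (ℕ → E)}
    (hC : IsCylAt n C) (hn : n ≤ h.length) : Cyl.tls h C = Set.univ ∨ Cyl.tls h C = ∅ :=
  IsCylAt.eq_univ_or_empty (IsCylAt.tls h (by simpa using hC.mono hn))

variable {E : Type} [MeasurableSpace E]

lemma measurable_scons (e : E) : Measurable (scons e) := by
  refine measurable_pi_lambda _ fun n => ?_
  cases n with
  | zero => exact measurable_const
  | succ n => exact measurable_pi_apply n

lemma measurableSet_tl (e : E) {s : Set (ℕ → E)} (hs : MeasurableSet s) :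
    MeasurableSet (tl e s) := measurable_scons e hs

lemma measurableSet_tls (h : List E) {s : Set (ℕ → E)} (hs : MeasurableSet s) :
    MeasurableSet (tls h s) := by
  induction h with
  | nil => exact hs
  | cons e h ih => exact measurableSet_tl e ih

end Cyl

namespace MDP

open Cyl

variable {V A : Type} [Fintype V] [Fintype A] {M : MDP V A}

lemma Strategy.ext_act {σ τ : M.Strategy} (h : ∀ l v a, σ.act l v a = τ.act l v a) : σ = τ := by
  cases σ; cases τ
  congr
  funext l v a
  exact h l v a

/-- The strategy after the history `h`. -/
def Strategy.shift (σ : M.Strategy) (h : List (V × A)) : M.Strategy where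
  act l := σ.act (l ++ h)
  act_nonneg _ := σ.act_nonneg _
  act_support _ := σ.act_support _
  act_sum _ := σ.act_sum _

@[simp] lemma Strategy.shift_nil (σ : M.Strategy) : σ.shift [] = σ :=
  Strategy.ext_act fun l v a => by simp [Strategy.shift]

lemma Strategy.shift_shift (σ : M.Strategy) (h h' : List (V × A)) :
    (σ.shift h).shift h' = σ.shift (h' ++ h) :=
  Strategy.ext_act fun l v a => by simp [Strategy.shift]

/-- The one-step expectation operator of a strategy. -/
noncomputable def Strategy.op (σ : M.Strategy) :
    (List (V × A) → V → ℝ) →ₗ[ℝ] (List (V × A) → V → ℝ) where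
  toFun Φ h v := ∑ a, σ.act h v a * ∑ v', M.p v a v' * Φ ((v, a) :: h) v'
  map_add' Φ Φ' := by
    ext h v
    simp [mul_add, Finset.sum_add_distrib]
  map_smul' c Φ := by
    ext h v
    simp only [Pi.smul_apply, smul_eq_mul, RingHom.id_apply, Finset.mul_sum]
    refine Finset.sum_congr rfl fun a _ => Finset.sum_congr rfl fun v' _ => ?_
    ring

lemma Strategy.op_apply (σ : M.Strategy) (Φ : List (V × A) → V → ℝ) (h : List (V × A)) (v : V) :
    σ.op Φ h v = ∑ a, σ.act h v a * ∑ v', M.p v a v' * Φ ((v, a) :: h) v' := rfl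

lemma Strategy.act_mul_sum_p (σ : M.Strategy) (h : List (V × A)) (v : V) (a : A) :
    σ.act h v a * ∑ v', M.p v a v' = σ.act h v a := by
  by_cases ha : a ∈ M.enabled v
  · rw [M.p_sum v a ha, mul_one]
  · rw [σ.act_support h v a ha, zero_mul]

lemma Strategy.op_const (σ : M.Strategy) (c : ℝ) : σ.op (fun _ _ => c) = fun _ _ => c := by
  ext h v
  simp_rw [op_apply, ← Finset.sum_mul, ← mul_assoc, act_mul_sum_p, ← Finset.sum_mul, act_sum,
    one_mul]

lemma Strategy.op_pow_const (σ : M.Strategy) (c : ℝ) (n : ℕ) :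
    (σ.op ^ n) (fun _ _ => c) = fun _ _ => c := by
  induction n with
  | zero => rfl
  | succ n ih => rw [pow_succ, Module.End.mul_apply, op_const, ih]

/-- `I` is preserved along the steps of `σ` of positive probability. -/
def Strategy.Inv (σ : M.Strategy) (I : List (V × A) → V → Prop) : Prop :=
  ∀ h v a v', I h v → 0 < σ.act h v a → 0 < M.p v a v' → I ((v, a) :: h) v'

lemma Strategy.op_mono (σ : M.Strategy) {h : List (V × A)} {v : V}
    {Φ Φ' : List (V × A) → V → ℝ}
    (hΦ : ∀ a v', 0 < σ.act h v a → 0 < M.p v a v' → Φ ((v, a) :: h) v' ≤ Φ' ((v, a) :: h) v') :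
    σ.op Φ h v ≤ σ.op Φ' h v := by
  refine Finset.sum_le_sum fun a _ => ?_
  rcases (σ.act_nonneg h v a).eq_or_lt with h0 | h0
  · simp [← h0]
  refine mul_le_mul_of_nonneg_left (Finset.sum_le_sum fun v' _ => ?_) h0.le
  rcases (M.p_nonneg v a v').eq_or_lt with h1 | h1
  · simp [← h1]
  exact mul_le_mul_of_nonneg_left (hΦ a v' h0 h1) h1.le

lemma Strategy.op_pow_mono (σ : M.Strategy) {I : List (V × A) → V → Prop} (hI : σ.Inv I)
    {Φ Φ' : List (V × A) → V → ℝ} (n : ℕ) {N : ℕ}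
    (hΦ : ∀ h v, I h v → h.length = N + n → Φ h v ≤ Φ' h v) :
    ∀ h v, I h v → h.length = N → (σ.op ^ n) Φ h v ≤ (σ.op ^ n) Φ' h v := by
  induction n generalizing N with
  | zero => exact fun h v hv hn => hΦ h v hv hn
  | succ n ih =>
    intro h v hv hn
    rw [pow_succ', Module.End.mul_apply, Module.End.mul_apply]
    refine σ.op_mono fun a v' h0 h1 => ?_
    exact ih (N := N + 1) (fun h v hv hh => hΦ h v hv (by omega)) _ _ (hI h v a v' hv h0 h1)
      (by simp [hn])

/-! ### Mixing strategies -/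

/-- The contribution of the strategy to the probability of a history. -/
noncomputable def Strategy.pw (σ : M.Strategy) : List (V × A) → ℝ
  | [] => 1
  | e :: l => σ.pw l * σ.act l e.1 e.2

lemma Strategy.pw_nonneg (σ : M.Strategy) (l : List (V × A)) : 0 ≤ σ.pw l := by
  induction l with
  | nil => simp [pw]
  | cons e l ih => exact mul_nonneg ih (σ.act_nonneg _ _ _)

/-- The strategy playing `σ` with probability `c` and `τ` with probability `d = 1 - c`. -/
noncomputable def Strategy.mix (σ τ : M.Strategy) (c d : ℝ) (hc : 0 ≤ c) (hd : 0 ≤ d) :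
    M.Strategy where
  act l v a := if c * σ.pw l + d * τ.pw l = 0 then σ.act l v a else
    (c * σ.pw l * σ.act l v a + d * τ.pw l * τ.act l v a) / (c * σ.pw l + d * τ.pw l)
  act_nonneg l v a := by
    have h1 := mul_nonneg hc (σ.pw_nonneg l)
    have h2 := mul_nonneg hd (τ.pw_nonneg l)
    have h3 := σ.act_nonneg l v a
    have h4 := τ.act_nonneg l v a
    split_ifs <;> positivity
  act_support l v a ha := by simp [σ.act_support l v a ha, τ.act_support l v a ha]
  act_sum l v := by
    split_ifs with h
    · exact σ.act_sum l v
    · rw [← Finset.sum_div, Finset.sum_add_distrib, ← Finset.mul_sum, ← Finset.mul_sum, σ.act_sum,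
        τ.act_sum, mul_one, mul_one, div_self h]

lemma Strategy.pw_mix (σ τ : M.Strategy) {c d : ℝ} (hc : 0 ≤ c) (hd : 0 ≤ d) (hcd : c + d = 1)
    (l : List (V × A)) : (σ.mix τ c d hc hd).pw l = c * σ.pw l + d * τ.pw l := by
  induction l with
  | nil => simp [pw, hcd]
  | cons e l ih =>
    simp only [pw, ih]
    simp only [mix]
    split_ifs with h
    · have h1 := mul_nonneg hc (σ.pw_nonneg l)
      have h2 := mul_nonneg hd (τ.pw_nonneg l)
      have h3 : c * σ.pw l = 0 := by linarith
      have h4 : d * τ.pw l = 0 := by linarith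
      rw [← mul_assoc, ← mul_assoc, h3, h4]
      ring
    · rw [mul_div_cancel₀ _ h]
      ring

variable [DecidableEq V]

/-- The contribution of the MDP to the probability of a history. -/
noncomputable def tw (M : MDP V A) (u : V) : List (V × A) → ℝ
  | [] => 1
  | e :: l => tw M u l * M.stepD u l e.1

lemma wt_eq_tw_mul_pw (σ : M.Strategy) (u : V) (l : List (V × A)) :
    M.wt σ u l = M.tw u l * σ.pw l := by
  induction l with
  | nil => simp [wt, tw, Strategy.pw]
  | cons e l ih => simp only [wt, tw, Strategy.pw, ih]; ring

lemma wt_append_singleton (σ : M.Strategy) (u : V) (l : List (V × A)) (e : V × A) :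
    M.wt σ u (l ++ [e]) = diracD u e.1 * σ.act [] e.1 e.2 *
      ∑ v', M.p e.1 e.2 v' * M.wt (σ.shift [e]) v' l := by
  induction l with
  | nil =>
    simp only [List.nil_append, wt, stepD, mul_one, one_mul]
    rw [mul_assoc, σ.act_mul_sum_p]
  | cons e' l ih =>
    rw [List.cons_append, wt, ih]
    rcases l with _ | ⟨e'', l⟩
    · simp only [wt, stepD, List.nil_append, one_mul, mul_one, Strategy.shift, diracD]
      rw [mul_assoc _ (σ.act [] e.1 e.2) (∑ _, _), σ.act_mul_sum_p]
      simp only [ite_mul, one_mul, zero_mul, mul_ite, mul_zero, Finset.sum_ite_eq, Finset.mem_univ,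
        if_true]
      split_ifs
      · ring
      · rfl
    · simp only [List.cons_append, wt, stepD, Strategy.shift, Finset.mul_sum, Finset.sum_mul]
      refine Finset.sum_congr rfl fun v' _ => ?_
      ring

variable [Nonempty V] [Nonempty A] [MeasurableSpace V] [DiscreteMeasurableSpace V]
  [MeasurableSpace A] [DiscreteMeasurableSpace A]

lemma tl_cylSet_append {E : Type} [DecidableEq E] (l : List E) (e e' : E) :
    tl e (cylSet (l ++ [e'])) = if e = e' then cylSet l else ∅ := by
  ext ω
  simp only [tl, cylSet, Set.mem_ofPred_eq, List.length_append, List.length_cons, List.length_nil,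
    zero_add, pre_scons]
  rw [← List.concat_eq_append, ← List.concat_eq_append, List.concat_inj]
  split_ifs with h <;> simp [h]

/-- The probability of the event `s`. -/
noncomputable def prob (σ : M.Strategy) (v : V) (s : Set (ℕ → V × A)) : ℝ := (M.law σ v).real s

lemma prob_nonneg (σ : M.Strategy) (v : V) (s : Set (ℕ → V × A)) : 0 ≤ prob σ v s :=
  measureReal_nonneg

lemma prob_le_one (σ : M.Strategy) (v : V) (s : Set (ℕ → V × A)) : prob σ v s ≤ 1 :=
  measureReal_le_one

@[simp] lemma prob_univ (σ : M.Strategy) (v : V) : prob σ v Set.univ = 1 := by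
  simp [prob]

@[simp] lemma prob_empty (σ : M.Strategy) (v : V) : prob σ v ∅ = 0 := by
  simp [prob]

/-- The one-step decomposition of the law. -/
lemma law_eq_sum (σ : M.Strategy) (u : V) :
    M.law σ u = ∑ a, ENNReal.ofReal (σ.act [] u a) • ∑ v', ENNReal.ofReal (M.p u a v') •
      (M.law (σ.shift [(u, a)]) v').map (scons (u, a)) := by
  classical
  refine measure_ext fun l => ?_
  have key : ∀ a, (∑ v', ENNReal.ofReal (M.p u a v') •
      (M.law (σ.shift [(u, a)]) v').map (scons (u, a))) (cylSet l) =
      ENNReal.ofReal (∑ v', M.p u a v' * (M.law (σ.shift [(u, a)]) v').real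
        (tl (u, a) (cylSet l))) := by
    intro a
    rw [Measure.finsetSum_apply, ENNReal.ofReal_sum_of_nonneg fun v' _ =>
      mul_nonneg (M.p_nonneg _ _ _) measureReal_nonneg]
    refine Finset.sum_congr rfl fun v' _ => ?_
    rw [Measure.smul_apply, Measure.map_apply (measurable_scons _) (measurableSet_cylSet l),
      ENNReal.ofReal_mul (M.p_nonneg _ _ _), ofReal_measureReal]
    rfl
  rw [Measure.finsetSum_apply]
  simp_rw [Measure.smul_apply, key, smul_eq_mul, ← ENNReal.ofReal_mul (σ.act_nonneg _ _ _)]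
  rw [← ENNReal.ofReal_sum_of_nonneg fun a _ => mul_nonneg (σ.act_nonneg _ _ _)
    (Finset.sum_nonneg fun v' _ => mul_nonneg (M.p_nonneg _ _ _) measureReal_nonneg), law_cylSet]
  congr 1
  rcases List.eq_nil_or_concat l with rfl | ⟨l', e, rfl⟩
  · have : ∀ a, tl (u, a) (cylSet ([] : List (V × A))) = Set.univ := fun a => by
      ext; simp [tl, cylSet, pre]
    simp_rw [this, probReal_univ, mul_one, σ.act_mul_sum_p, σ.act_sum]
    rfl
  · simp_rw [List.concat_eq_append, tl_cylSet_append, wt_append_singleton]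
    by_cases he : e.1 = u
    · obtain ⟨e1, e2⟩ := e
      dsimp only at he
      subst he
      rw [Finset.sum_eq_single e2]
      · simp [diracD, law_real_cylSet]
      · intro b _ hb
        simp [hb]
      · simp
    · have : ∀ a, (u, a) ≠ e := fun a h => he (by rw [← h])
      simp [this, diracD, he]

lemma prob_eq_sum (σ : M.Strategy) (u : V) {s : Set (ℕ → V × A)} (hs : MeasurableSet s) :
    prob σ u s = ∑ a, σ.act [] u a * ∑ v', M.p u a v' *
      prob (σ.shift [(u, a)]) v' (tl (u, a) s) := by
  have h := congrArg (fun μ => (μ s).toReal) (law_eq_sum σ u)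
  simp only [Measure.finsetSum_apply, Measure.smul_apply, smul_eq_mul] at h
  rw [prob, Measure.real, h, ENNReal.toReal_sum]
  · refine Finset.sum_congr rfl fun a _ => ?_
    rw [ENNReal.toReal_mul, ENNReal.toReal_ofReal (σ.act_nonneg _ _ _), ENNReal.toReal_sum]
    · congr 1
      refine Finset.sum_congr rfl fun v' _ => ?_
      rw [ENNReal.toReal_mul, ENNReal.toReal_ofReal (M.p_nonneg _ _ _),
        Measure.map_apply (measurable_scons _) hs]
      rfl
    · intro v' _
      rw [Measure.map_apply (measurable_scons _) hs]
      exact ENNReal.mul_ne_top (by simp) (measure_ne_top _ _)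
  · intro a _
    refine ENNReal.mul_ne_top (by simp) (ENNReal.sum_ne_top.2 fun v' _ => ?_)
    rw [Measure.map_apply (measurable_scons _) hs]
    exact ENNReal.mul_ne_top (by simp) (measure_ne_top _ _)

/-- The conditional probability of `s` after a history. -/
noncomputable def condProb (σ : M.Strategy) (s : Set (ℕ → V × A)) (h : List (V × A)) (v : V) : ℝ :=
  prob (σ.shift h) v (tls h s)

lemma op_condProb (σ : M.Strategy) {s : Set (ℕ → V × A)} (hs : MeasurableSet s) :
    σ.op (condProb σ s) = condProb σ s := by
  ext h v
  rw [condProb, prob_eq_sum _ _ (measurableSet_tls h hs), Strategy.op_apply]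
  refine Finset.sum_congr rfl fun a _ => ?_
  simp only [Strategy.shift_shift]
  rfl

lemma op_pow_condProb (σ : M.Strategy) {s : Set (ℕ → V × A)} (hs : MeasurableSet s) (n : ℕ) :
    (σ.op ^ n) (condProb σ s) = condProb σ s := by
  induction n with
  | zero => rfl
  | succ n ih => rw [pow_succ, Module.End.mul_apply, op_condProb _ hs, ih]

lemma condProb_nil (σ : M.Strategy) (s : Set (ℕ → V × A)) (v : V) :
    condProb σ s [] v = prob σ v s := by simp [condProb, tls]

lemma law_mix (σ τ : M.Strategy) {c d : ℝ} (hc : 0 ≤ c) (hd : 0 ≤ d) (hcd : c + d = 1) (u : V) :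
    M.law (σ.mix τ c d hc hd) u = ENNReal.ofReal c • M.law σ u + ENNReal.ofReal d • M.law τ u := by
  refine measure_ext fun l => ?_
  simp only [Measure.add_apply, Measure.smul_apply, smul_eq_mul, law_cylSet]
  have h1 := wt_nonneg M σ u l
  have h2 := wt_nonneg M τ u l
  rw [← ENNReal.ofReal_mul hc, ← ENNReal.ofReal_mul hd, ← ENNReal.ofReal_add (by positivity)
    (by positivity)]
  congr 1
  simp only [wt_eq_tw_mul_pw, Strategy.pw_mix _ _ hc hd hcd]
  ring

lemma prob_mix (σ τ : M.Strategy) {c d : ℝ} (hc : 0 ≤ c) (hd : 0 ≤ d) (hcd : c + d = 1) (u : V)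
    (s : Set (ℕ → V × A)) :
    prob (σ.mix τ c d hc hd) u s = c * prob σ u s + d * prob τ u s := by
  simp only [prob, Measure.real, law_mix σ τ hc hd hcd, Measure.add_apply, Measure.smul_apply,
    smul_eq_mul]
  rw [ENNReal.toReal_add (ENNReal.mul_ne_top (by simp) (measure_ne_top _ _))
    (ENNReal.mul_ne_top (by simp) (measure_ne_top _ _)), ENNReal.toReal_mul, ENNReal.toReal_mul,
    ENNReal.toReal_ofReal hc, ENNReal.toReal_ofReal hd]

end MDP

namespace MDP

open Cyl Filter Topology

/-! ### Objectives tracked by a finite memory -/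

variable {V A X : Type}

/-- The memory content after a history. -/
def memo (upd : X → V → X) (x : X) : List (V × A) → X
  | [] => x
  | e :: h => upd (memo upd x h) e.1

/-- A family of events indexed by memory contents, whose residuals are tracked by `upd`. -/
structure Tracked (A : Type) [MeasurableSpace V] [MeasurableSpace A] (upd : X → V → X) where
  ev : X → Set (ℕ → V × A)
  measurableSet_ev : ∀ x, MeasurableSet (ev x)
  tl_ev : ∀ x e, tl e (ev x) = ev (upd x e.1)

lemma Tracked.tls_ev [MeasurableSpace V] [MeasurableSpace A] {upd : X → V → X}
    (G : Tracked A upd) (x : X) (h : List (V × A)) : tls h (G.ev x) = G.ev (memo upd x h) := by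
  induction h with
  | nil => rfl
  | cons e h ih => rw [tls, ih, G.tl_ev]; rfl

lemma exists_forall_of_antitone {ι : Type*} [Finite ι] {P : ι → ℝ → Prop}
    (hP : ∀ i, ∃ ε > 0, P i ε) (hanti : ∀ i ε ε', ε' ≤ ε → P i ε → P i ε') :
    ∃ ε > 0, ε ≤ 1 ∧ ∀ i, P i ε := by
  have h : ∀ᶠ ε in 𝓝[>] (0 : ℝ), ∀ i, P i ε := by
    refine eventually_all.2 fun i => ?_
    obtain ⟨ε, h0, h⟩ := hP i
    filter_upwards [Ioc_mem_nhdsGT h0] with ε' h' using hanti i ε ε' h'.2 h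
  obtain ⟨ε, h1, h2⟩ := (h.and (Ioc_mem_nhdsGT one_pos)).exists
  exact ⟨ε, h2.1, h2.2, h1⟩

variable [Fintype V] [Fintype A] {M : MDP V A}

/-- The strategy playing `q` first when starting at `v`, and following `σ` afterwards. -/
noncomputable def Strategy.setFirst [DecidableEq V] (σ : M.Strategy) (v : V) (q : A → ℝ)
    (h0 : ∀ a, 0 ≤ q a) (hs : ∀ a, a ∉ M.enabled v → q a = 0) (h1 : ∑ a, q a = 1) :
    M.Strategy where
  act h v' a := if h = [] ∧ v' = v then q a else σ.act h v' a
  act_nonneg h v' a := by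
    split_ifs
    exacts [h0 a, σ.act_nonneg _ _ _]
  act_support h v' a ha := by
    split_ifs with h
    · rw [h.2] at ha
      exact hs a ha
    · exact σ.act_support _ _ _ ha
  act_sum h v' := by
    by_cases h : h = [] ∧ v' = v
    · simp only [if_pos h, h1]
    · simp only [if_neg h, σ.act_sum]

lemma Strategy.setFirst_shift [DecidableEq V] (σ : M.Strategy) (v : V) (q : A → ℝ)
    (h0 : ∀ a, 0 ≤ q a) (hs : ∀ a, a ∉ M.enabled v → q a = 0) (h1 : ∑ a, q a = 1) (e : V × A) :
    (σ.setFirst v q h0 hs h1).shift [e] = σ.shift [e] :=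
  Strategy.ext_act fun l v a => by simp [Strategy.shift, setFirst]

variable [DecidableEq V] [Nonempty V] [Nonempty A] [MeasurableSpace V] [DiscreteMeasurableSpace V]
  [MeasurableSpace A] [DiscreteMeasurableSpace A] {upd : X → V → X}

/-- The objective can be achieved from `v` with probability arbitrarily close to one. -/
def LimitSure (M : MDP V A) (G : Tracked A upd) (v : V) (x : X) : Prop :=
  ∀ ε > 0, ∃ σ : M.Strategy, 1 - ε < prob σ v (G.ev x)

/-- The action `a` keeps the objective limit-sure. -/
def Safe (M : MDP V A) (G : Tracked A upd) (v : V) (x : X) (a : A) : Prop :=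
  ∀ v', 0 < M.p v a v' → LimitSure M G v' (upd x v)

lemma exists_gap_of_not_safe [Finite X] (M : MDP V A) (G : Tracked A upd) :
    ∃ η > 0, η ≤ 1 ∧ ∀ v x a, a ∈ M.enabled v → ¬ Safe M G v x a → ∀ s : V → M.Strategy,
      ∑ v', M.p v a v' * prob (s v') v' (G.ev (upd x v)) ≤ 1 - η := by
  have := exists_forall_of_antitone (ι := V × X × A) (P := fun i η => i.2.2 ∈ M.enabled i.1 →
    ¬ Safe M G i.1 i.2.1 i.2.2 → ∀ s : V → M.Strategy,
      ∑ v', M.p i.1 i.2.2 v' * prob (s v') v' (G.ev (upd i.2.1 i.1)) ≤ 1 - η) ?_ ?_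
  · obtain ⟨η, h0, h1, h⟩ := this
    exact ⟨η, h0, h1, fun v x a => h (v, x, a)⟩
  · rintro ⟨v, x, a⟩
    by_cases ha : a ∈ M.enabled v
    swap
    · exact ⟨1, one_pos, fun h => absurd h ha⟩
    by_cases hs : Safe M G v x a
    · exact ⟨1, one_pos, fun _ h => absurd hs h⟩
    simp only [Safe, LimitSure, not_forall, not_exists, not_lt, exists_prop] at hs
    obtain ⟨v0, hp, ε, hε, hv0⟩ := hs
    refine ⟨M.p v a v0 * ε, mul_pos hp hε, fun _ _ s => ?_⟩
    dsimp only
    rw [← M.p_sum v a ha, ← Finset.add_sum_erase _ _ (Finset.mem_univ v0),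
      ← Finset.add_sum_erase (Finset.univ) (M.p v a) (Finset.mem_univ v0)]
    have h1 := mul_le_mul_of_nonneg_left (hv0 (s v0)) hp.le
    have h2 : ∑ v' ∈ Finset.univ.erase v0, M.p v a v' * prob (s v') v' (G.ev (upd x v)) ≤
        ∑ v' ∈ Finset.univ.erase v0, M.p v a v' :=
      Finset.sum_le_sum fun v' _ => mul_le_of_le_one_right (M.p_nonneg _ _ _) (prob_le_one _ _ _)
    linarith
  · exact fun i ε ε' hε h h1 h2 s => (h h1 h2 s).trans (by linarith)

/-- The value of an action for an event, when the rest of the play follows `σ`. -/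
noncomputable def actVal (σ : M.Strategy) (v : V) (s : Set (ℕ → V × A)) (a : A) : ℝ :=
  ∑ v', M.p v a v' * prob (σ.shift [(v, a)]) v' (tl (v, a) s)

lemma actVal_nonneg (σ : M.Strategy) (v : V) (s : Set (ℕ → V × A)) (a : A) :
    0 ≤ actVal σ v s a :=
  Finset.sum_nonneg fun _ _ => mul_nonneg (M.p_nonneg _ _ _) (prob_nonneg _ _ _)

lemma actVal_le_one (σ : M.Strategy) (v : V) (s : Set (ℕ → V × A)) {a : A}
    (ha : a ∈ M.enabled v) : actVal σ v s a ≤ 1 := by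
  rw [← M.p_sum v a ha]
  exact Finset.sum_le_sum fun v' _ =>
    mul_le_of_le_one_right (M.p_nonneg _ _ _) (prob_le_one _ _ _)

lemma exists_condition_safe (G : Tracked A upd) {η : ℝ} (hη : 0 < η)
    (hgap : ∀ v x a, a ∈ M.enabled v → ¬ Safe M G v x a → ∀ s : V → M.Strategy,
      ∑ v', M.p v a v' * prob (s v') v' (G.ev (upd x v)) ≤ 1 - η)
    (v : V) (x : X) (σ : M.Strategy) (hσ : 1 - η / 2 ≤ prob σ v (G.ev x)) :
    ∃ τ : M.Strategy, (∀ a, 0 < τ.act [] v a → Safe M G v x a) ∧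
      prob σ v (G.ev x) ≤ prob τ v (G.ev x) ∧
      ∀ s, MeasurableSet s → |prob τ v s - prob σ v s| ≤
        4 / η * (prob τ v (G.ev x) - prob σ v (G.ev x)) := by
  classical
  set q : A → ℝ := σ.act [] v with hq
  have hq0 : ∀ a, 0 ≤ q a := σ.act_nonneg [] v
  set S : Finset A := Finset.univ.filter (Safe M G v x) with hS
  have hU : ∀ a ∉ S, a ∈ M.enabled v → actVal σ v (G.ev x) a ≤ 1 - η := by
    intro a ha he
    have := hgap v x a he (by simpa [hS] using ha) fun v' => σ.shift [(v, a)]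
    simpa only [actVal, G.tl_ev] using this
  have hsplit : ∀ f : A → ℝ, ∑ a, q a * f a = ∑ a ∈ S, q a * f a + ∑ a ∈ Sᶜ, q a * f a :=
    fun f => (Finset.sum_add_sum_compl S _).symm
  have hst : ∑ a ∈ S, q a + ∑ a ∈ Sᶜ, q a = 1 := by
    rw [Finset.sum_add_sum_compl]; exact σ.act_sum [] v
  set m := ∑ a ∈ S, q a with hm
  set t := ∑ a ∈ Sᶜ, q a with ht
  have ht0 : 0 ≤ t := Finset.sum_nonneg fun a _ => hq0 a
  have hle : ∀ (T : Finset A) (s : Set (ℕ → V × A)) (c : ℝ),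
      (∀ a ∈ T, a ∈ M.enabled v → actVal σ v s a ≤ c) →
      ∑ a ∈ T, q a * actVal σ v s a ≤ (∑ a ∈ T, q a) * c := by
    intro T s c h
    rw [Finset.sum_mul]
    refine Finset.sum_le_sum fun a ha => ?_
    by_cases he : a ∈ M.enabled v
    · exact mul_le_mul_of_nonneg_left (h a ha he) (hq0 a)
    · simp [hq, σ.act_support [] v a he]
  have hge : ∀ (T : Finset A) (s : Set (ℕ → V × A)), 0 ≤ ∑ a ∈ T, q a * actVal σ v s a :=
    fun T s => Finset.sum_nonneg fun a _ => mul_nonneg (hq0 a) (actVal_nonneg _ _ _ _)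
  have hval : ∀ s, MeasurableSet s → prob σ v s =
      ∑ a ∈ S, q a * actVal σ v s a + ∑ a ∈ Sᶜ, q a * actVal σ v s a := by
    intro s hs
    rw [prob_eq_sum σ v hs]
    exact hsplit _
  have hU1 := hle Sᶜ (G.ev x) (1 - η) fun a ha => hU a (by simpa using ha)
  have hS1 := hle S (G.ev x) 1 fun a _ => actVal_le_one σ v _
  have hσ' := hσ
  rw [hval _ (G.measurableSet_ev x)] at hσ'
  have hm0 : 0 < m := by
    by_contra! h
    have : (1 - η) * t ≤ 1 - η := by nlinarith
    nlinarith
  let q' : A → ℝ := fun a => if a ∈ S then q a / m else 0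
  have hq'1 : ∑ a, q' a = 1 := by
    simp only [q', Finset.sum_ite_mem, Finset.univ_inter, ← Finset.sum_div]
    exact div_self hm0.ne'
  let τ := σ.setFirst v q' (fun a => by
      simp only [q']; split_ifs
      exacts [div_nonneg (hq0 a) hm0.le, le_rfl])
    (fun a ha => by simp [q', hq, σ.act_support [] v a ha]) hq'1
  have hτ : ∀ s, MeasurableSet s → prob τ v s = (∑ a ∈ S, q a * actVal σ v s a) / m := by
    intro s hs
    rw [prob_eq_sum τ v hs, Finset.sum_div]
    have : ∀ a, τ.act [] v a = q' a := fun a => by simp [τ, Strategy.setFirst]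
    simp only [this, τ, Strategy.setFirst_shift]
    simp only [q', ite_mul, zero_mul, Finset.sum_ite_mem, Finset.univ_inter]
    refine Finset.sum_congr rfl fun a _ => ?_
    rw [div_mul_eq_mul_div]
    rfl
  have hg := hτ _ (G.measurableSet_ev x)
  have hg' : ∑ a ∈ S, q a * actVal σ v (G.ev x) a = m * prob τ v (G.ev x) := by
    rw [hg, mul_div_cancel₀ _ hm0.ne']
  rw [hg'] at hσ' hS1
  have h1 : 1 - η / 2 ≤ prob τ v (G.ev x) := by
    have : m * (1 - η / 2) ≤ m * prob τ v (G.ev x) := by nlinarith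
    exact le_of_mul_le_mul_left this hm0
  have h2 : t * (η / 2) ≤ prob τ v (G.ev x) - prob σ v (G.ev x) := by
    rw [hval _ (G.measurableSet_ev x), hg']
    have : m = 1 - t := by linarith
    rw [this]
    nlinarith
  refine ⟨τ, ?_, ?_, ?_⟩
  · intro a ha
    by_contra hs
    have : τ.act [] v a = 0 := by simp [τ, Strategy.setFirst, q', hS, hs]
    exact ha.ne' this
  · have : 0 ≤ t * (η / 2) := by positivity
    linarith
  · intro s hs
    have h3 : t ≤ 4 / η * (prob τ v (G.ev x) - prob σ v (G.ev x)) := by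
      have h4 := mul_le_mul_of_nonneg_left h2 (show 0 ≤ 4 / η by positivity)
      have h5 : 4 / η * (t * (η / 2)) = 2 * t := by field_simp; ring
      linarith
    refine le_trans ?_ h3
    rw [hval s hs]
    have h6 : ∑ a ∈ S, q a * actVal σ v s a = m * prob τ v s := by
      rw [hτ s hs, mul_div_cancel₀ _ hm0.ne']
    rw [h6]
    have h7 := hle Sᶜ s 1 fun a _ => actVal_le_one σ v s
    have h8 := hge Sᶜ s
    have h9 := prob_nonneg τ v s
    have h10 := prob_le_one τ v s
    have : m = 1 - t := by linarith
    rw [this, abs_le]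
    constructor <;> nlinarith

lemma exists_improve (G : Tracked A upd) {η : ℝ} (hη : 0 < η)
    (hgap : ∀ v x a, a ∈ M.enabled v → ¬ Safe M G v x a → ∀ s : V → M.Strategy,
      ∑ v', M.p v a v' * prob (s v') v' (G.ev (upd x v)) ≤ 1 - η)
    {v : V} {x : X} (hW : LimitSure M G v x) (σ : M.Strategy) :
    ∃ τ : M.Strategy, (∀ a, 0 < τ.act [] v a → Safe M G v x a) ∧
      1 - η / 2 ≤ prob τ v (G.ev x) ∧
      ∀ s, MeasurableSet s → |prob τ v s - prob σ v s| ≤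
        4 / η * (prob τ v (G.ev x) - prob σ v (G.ev x)) := by
  by_cases hσ : 1 - η / 2 ≤ prob σ v (G.ev x)
  · obtain ⟨τ, h1, h2, h3⟩ := exists_condition_safe G hη hgap v x σ hσ
    exact ⟨τ, h1, hσ.trans h2, h3⟩
  · obtain ⟨σ1, h1⟩ := hW (η / 4) (by positivity)
    obtain ⟨τ, h2, h3, -⟩ := exists_condition_safe G hη hgap v x σ1 (by linarith)
    refine ⟨τ, h2, by linarith, fun s _ => ?_⟩
    have h4 : 4 / η * (η / 4) ≤ 4 / η * (prob τ v (G.ev x) - prob σ v (G.ev x)) :=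
      mul_le_mul_of_nonneg_left (by linarith) (by positivity)
    have h5 : 4 / η * (η / 4) = 1 := by field_simp
    have := prob_nonneg τ v s
    have := prob_le_one τ v s
    have := prob_nonneg σ v s
    have := prob_le_one σ v s
    rw [abs_le]
    constructor <;> linarith

end MDP

namespace MDP

open Cyl Filter Topology

variable {V A X : Type} [Fintype V] [Fintype A] {M : MDP V A}

/-! ### Strategies revising their plan after every step -/

/-- The plan in force after a history, when plans are revised by `imp`. -/
noncomputable def plan (imp : V → X → M.Strategy → M.Strategy) (upd : X → V → X) (x : X)
    (σ : M.Strategy) : List (V × A) → V → M.Strategy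
  | [], v => imp v x σ
  | e :: h, v => imp v (memo upd x (e :: h)) ((plan imp upd x σ h e.1).shift [e])

/-- The strategy that always plays the first action of the plan in force. -/
noncomputable def followPlan (π : List (V × A) → V → M.Strategy) : M.Strategy where
  act h v := (π h v).act [] v
  act_nonneg h v := (π h v).act_nonneg [] v
  act_support h v := (π h v).act_support [] v
  act_sum h v := (π h v).act_sum [] v

variable [MeasurableSpace V] [DiscreteMeasurableSpace V]
  [MeasurableSpace A] [DiscreteMeasurableSpace A] {upd : X → V → X}

lemma exists_measure_sum {ι Ω : Type*} [MeasurableSpace Ω] (s : Finset ι) {c : ι → ℝ}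
    (hc : ∀ i, 0 ≤ c i) {f : ι → Set Ω → ℝ}
    (hf : ∀ i, ∃ ν : Measure Ω, IsFiniteMeasure ν ∧ ∀ E, MeasurableSet E → f i E = ν.real E) :
    ∃ ν : Measure Ω, IsFiniteMeasure ν ∧
      ∀ E, MeasurableSet E → ∑ i ∈ s, c i * f i E = ν.real E := by
  choose ν hν h using hf
  classical
  induction s using Finset.induction_on with
  | empty => exact ⟨0, inferInstance, fun E _ => by simp⟩
  | insert i s hi ih =>
    obtain ⟨ν', hν', h'⟩ := ih
    refine ⟨(c i).toNNReal • ν i + ν', inferInstance, fun E hE => ?_⟩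
    rw [Finset.sum_insert hi, h' E hE, h i E hE, measureReal_add_apply,
      measureReal_nnreal_smul_apply, Real.coe_toNNReal _ (hc i)]

lemma exists_measure_op_pow (σ : M.Strategy) {Φ : Set (ℕ → V × A) → List (V × A) → V → ℝ}
    (hΦ : ∀ h v, ∃ ν : Measure (ℕ → V × A), IsFiniteMeasure ν ∧
      ∀ E, MeasurableSet E → Φ E h v = ν.real E) (n : ℕ) :
    ∀ h v, ∃ ν : Measure (ℕ → V × A), IsFiniteMeasure ν ∧
      ∀ E, MeasurableSet E → (σ.op ^ n) (Φ E) h v = ν.real E := by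
  induction n with
  | zero => exact hΦ
  | succ n ih =>
    intro h v
    simp only [pow_succ', Module.End.mul_apply, Strategy.op_apply]
    exact exists_measure_sum _ (σ.act_nonneg h v) fun a =>
      exists_measure_sum _ (M.p_nonneg v a) fun v' => ih ((v, a) :: h) v'

variable [DecidableEq V] [Nonempty V] [Nonempty A]

/-- The probability of an event after a history when the plan in force is followed. -/
noncomputable def planProb (π : List (V × A) → V → M.Strategy) (s : Set (ℕ → V × A))
    (h : List (V × A)) (v : V) : ℝ := prob (π h v) v (tls h s)

lemma exists_measure_tls (h : List (V × A)) (μ : Measure (ℕ → V × A)) [IsFiniteMeasure μ] :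
    ∃ ν : Measure (ℕ → V × A), IsFiniteMeasure ν ∧
      ∀ E, MeasurableSet E → μ.real (tls h E) = ν.real E := by
  induction h generalizing μ with
  | nil => exact ⟨μ, inferInstance, fun E _ => rfl⟩
  | cons e h ih =>
    obtain ⟨ν, hν, h'⟩ := ih (μ.map (scons e))
    refine ⟨ν, hν, fun E hE => ?_⟩
    rw [← h' E hE, map_measureReal_apply (measurable_scons e) (measurableSet_tls h hE)]
    rfl

lemma op_pow_planProb_of_isCylAt (π : List (V × A) → V → M.Strategy) {C : Set (ℕ → V × A)} {n : ℕ}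
    (hC : IsCylAt n C) (v : V) :
    ((followPlan π).op ^ n) (planProb π C) [] v = prob (followPlan π) v C := by
  have h : ∀ h v, True → h.length = 0 + n → planProb π C h v = condProb (followPlan π) C h v := by
    intro h v _ hn
    rw [planProb, condProb]
    rcases hC.tls_eq (h := h) (by omega) with h | h <;> simp [h]
  have hI : (followPlan π).Inv fun _ _ => True := fun _ _ _ _ _ _ _ => trivial
  rw [← condProb_nil, ← op_pow_condProb _ hC.measurableSet n]
  exact le_antisymm
    (Strategy.op_pow_mono _ hI n (fun l v ht hl => (h l v ht hl).le) [] v trivial rfl)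
    (Strategy.op_pow_mono _ hI n (fun l v ht hl => (h l v ht hl).ge) [] v trivial rfl)

/-- An objective that is limit-sure can be achieved with probability one. -/
lemma exists_prob_eq_one_of_limitSure [Finite X] (G : Tracked A upd) {v : V} {x : X}
    (hW : LimitSure M G v x) : ∃ σ : M.Strategy, prob σ v (G.ev x) = 1 := by
  obtain ⟨η, hη, hη1, hgap⟩ := exists_gap_of_not_safe M G
  have himp : ∀ v x (σ : M.Strategy), ∃ τ : M.Strategy, LimitSure M G v x →
      (∀ a, 0 < τ.act [] v a → Safe M G v x a) ∧ 1 - η / 2 ≤ prob τ v (G.ev x) ∧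
      ∀ s, MeasurableSet s → |prob τ v s - prob σ v s| ≤
        4 / η * (prob τ v (G.ev x) - prob σ v (G.ev x)) := by
    intro v x σ
    by_cases hW : LimitSure M G v x
    · obtain ⟨τ, h⟩ := exists_improve G hη hgap hW σ
      exact ⟨τ, fun _ => h⟩
    · exact ⟨σ, fun h => absurd h hW⟩
  choose imp himp using himp
  obtain ⟨σ0, -⟩ := hW 1 one_pos
  set π := plan imp upd x σ0 with hπ
  set τ := followPlan π with hτ
  set K := 4 / η with hK
  have hK0 : 0 < K := by positivity
  let I : List (V × A) → V → Prop := fun h v => LimitSure M G v (memo upd x h)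
  have hmeas := G.measurableSet_ev x
  have hsafe : ∀ h v, I h v → (∀ a, 0 < τ.act h v a → Safe M G v (memo upd x h) a) ∧
      1 - η / 2 ≤ planProb π (G.ev x) h v := by
    intro h v hI
    simp only [planProb, G.tls_ev]
    cases h with
    | nil => exact ⟨(himp v x σ0 hI).1, (himp v x σ0 hI).2.1⟩
    | cons e h => exact ⟨(himp v _ _ hI).1, (himp v _ _ hI).2.1⟩
  have hInv : τ.Inv I := fun h v a v' hI ha hp => (hsafe h v hI).1 a ha v' hp
  let old : Set (ℕ → V × A) → List (V × A) → V → ℝ := fun s h v' =>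
    match h with
    | [] => 0
    | e :: h => prob ((π h e.1).shift [e]) v' (tls (e :: h) s)
  have hold : ∀ s, MeasurableSet s → τ.op (old s) = planProb π s := by
    intro s hs
    ext h v
    rw [planProb, prob_eq_sum _ _ (measurableSet_tls h hs)]
    rfl
  have hstep : ∀ s, MeasurableSet s → ∀ e h v, I (e :: h) v →
      |planProb π s (e :: h) v - old s (e :: h) v| ≤
        K * (planProb π (G.ev x) (e :: h) v - old (G.ev x) (e :: h) v) := by
    intro s hs e h v hI
    simp only [planProb, old]
    have := (himp v _ ((π h e.1).shift [e]) hI).2.2 (tls (e :: h) s) (measurableSet_tls _ hs)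
    rw [← G.tls_ev] at this
    exact this
  -- one revision changes the probabilities by at most `K` times the gain
  have hone : ∀ s, MeasurableSet s → ∀ h v, I h v →
      |τ.op (planProb π s) h v - planProb π s h v| ≤
        K * (τ.op (planProb π (G.ev x)) h v - planProb π (G.ev x) h v) := by
    intro s hs h v hI
    have e1 : ∀ s, MeasurableSet s → τ.op (planProb π s) h v - planProb π s h v =
        τ.op (planProb π s - old s) h v := fun s hs => by
      rw [map_sub, hold s hs]; rfl
    rw [e1 s hs, e1 _ hmeas, abs_le]
    have e2 : K * τ.op (planProb π (G.ev x) - old (G.ev x)) h v =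
        τ.op (K • (planProb π (G.ev x) - old (G.ev x))) h v := by rw [map_smul]; rfl
    constructor
    · rw [e2, ← Pi.neg_apply, ← Pi.neg_apply, ← map_neg]
      refine τ.op_mono fun a v' ha hp => ?_
      exact (abs_le.1 (hstep s hs _ h v' (hInv h v a v' hI ha hp))).1
    · rw [e2]
      refine τ.op_mono fun a v' ha hp => ?_
      exact (abs_le.1 (hstep s hs _ h v' (hInv h v a v' hI ha hp))).2
  let Q : Set (ℕ → V × A) → ℕ → ℝ := fun s n => (τ.op ^ n) (planProb π s) [] v
  have hQstep : ∀ s, MeasurableSet s → ∀ n,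
      |Q s (n + 1) - Q s n| ≤ K * (Q (G.ev x) (n + 1) - Q (G.ev x) n) := by
    intro s hs n
    have e1 : ∀ s, Q s (n + 1) - Q s n =
        (τ.op ^ n) (τ.op (planProb π s) - planProb π s) [] v := fun s => by
      simp only [Q]
      rw [map_sub, pow_succ]; rfl
    have e2 : K * (τ.op ^ n) (τ.op (planProb π (G.ev x)) - planProb π (G.ev x)) [] v =
        (τ.op ^ n) (K • (τ.op (planProb π (G.ev x)) - planProb π (G.ev x))) [] v := by
      rw [map_smul]; rfl
    rw [e1, e1, abs_le]
    constructor
    · rw [e2, ← Pi.neg_apply, ← Pi.neg_apply, ← map_neg]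
      exact Strategy.op_pow_mono _ hInv n (N := 0)
        (fun h v hI _ => (abs_le.1 (hone s hs h v hI)).1) [] v hW rfl
    · rw [e2]
      exact Strategy.op_pow_mono _ hInv n (N := 0)
        (fun h v hI _ => (abs_le.1 (hone s hs h v hI)).2) [] v hW rfl
  have hQ : ∀ s, MeasurableSet s → ∀ m n, m ≤ n →
      |Q s n - Q s m| ≤ K * (Q (G.ev x) n - Q (G.ev x) m) := by
    intro s hs m n hmn
    induction n, hmn using Nat.le_induction with
    | base => simp
    | succ n hn ih =>
      have := hQstep s hs n
      have h3 := abs_sub_le (Q s (n + 1)) (Q s n) (Q s m)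
      linarith
  have hmono : Monotone (Q (G.ev x)) := by
    refine monotone_nat_of_le_succ fun n => ?_
    have := (abs_nonneg _).trans (hQstep _ hmeas n)
    have := nonneg_of_mul_nonneg_right this hK0
    linarith
  have hQ1 : ∀ n, Q (G.ev x) n ≤ 1 := by
    intro n
    have := Strategy.op_pow_mono τ hInv n (N := 0) (Φ := planProb π (G.ev x))
      (Φ' := fun _ _ => 1) (fun h v _ _ => prob_le_one _ _ _) [] v hW rfl
    rwa [Strategy.op_pow_const] at this
  have hbdd : BddAbove (Set.range (Q (G.ev x))) := ⟨1, by rintro _ ⟨n, rfl⟩; exact hQ1 n⟩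
  have hcauchy : ∀ ε > 0, ∃ m, ∀ n ≥ m, ∀ k ≥ n, ∀ s, MeasurableSet s → |Q s k - Q s n| ≤ ε := by
    intro ε hε
    obtain ⟨m, hm⟩ := exists_lt_of_lt_ciSup
      (show (⨆ n, Q (G.ev x) n) - ε / K < ⨆ n, Q (G.ev x) n by linarith [div_pos hε hK0])
    refine ⟨m, fun n hn k hk s hs => (hQ s hs n k hk).trans ?_⟩
    have h1 := le_ciSup hbdd k
    have h2 := hmono hn
    have : Q (G.ev x) k - Q (G.ev x) n ≤ ε / K := by linarith
    calc K * (Q (G.ev x) k - Q (G.ev x) n) ≤ K * (ε / K) := mul_le_mul_of_nonneg_left this hK0.le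
      _ = ε := by field_simp
  have hcyl : ∀ {C : Set (ℕ → V × A)} {n}, IsCylAt n C → Q C n = prob τ v C := fun hC =>
    op_pow_planProb_of_isCylAt π hC v
  have hlim : ∀ ε > 0, ∃ m, ∀ n ≥ m, ∀ s, MeasurableSet s → |prob τ v s - Q s n| ≤ ε := by
    intro ε hε
    obtain ⟨m, hm⟩ := hcauchy (ε / 3) (by positivity)
    refine ⟨m, fun n hn s hs => ?_⟩
    obtain ⟨ν, hν, hνQ⟩ := exists_measure_op_pow τ (Φ := planProb π)
      (fun h v => exists_measure_tls h (M.law (π h v) v)) n [] v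
    obtain ⟨N, C, hC, hlt⟩ := exists_isCylAt_approx (M.law τ v + ν) hs
      (show 0 < ε / 3 by positivity)
    rw [measureReal_add_apply] at hlt
    have h1 : |prob τ v C - prob τ v s| ≤ ε / 3 := by
      refine (abs_measureReal_sub_le_measureReal_symmDiff hC.measurableSet.nullMeasurableSet
        hs.nullMeasurableSet).trans ?_
      have : 0 ≤ ν.real (symmDiff C s) := measureReal_nonneg
      linarith
    have h2 : |Q C n - Q s n| ≤ ε / 3 := by
      simp only [Q]
      rw [hνQ C hC.measurableSet, hνQ s hs]
      refine (abs_measureReal_sub_le_measureReal_symmDiff hC.measurableSet.nullMeasurableSet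
        hs.nullMeasurableSet).trans ?_
      have : 0 ≤ (M.law τ v).real (symmDiff C s) := measureReal_nonneg
      linarith
    have h3 := hm n hn (max n N) (le_max_left _ _) C hC.measurableSet
    rw [hcyl (hC.mono (le_max_right _ _))] at h3
    rw [abs_le] at *
    constructor <;> linarith
  refine ⟨τ, ?_⟩
  have hhalf : ∀ {C : Set (ℕ → V × A)} {N}, IsCylAt N C →
      1 / 2 * prob τ v C ≤ prob τ v (G.ev x ∩ C) := by
    intro C N hC
    refine le_of_forall_pos_le_add fun ε hε => ?_
    obtain ⟨m, hm⟩ := hlim ε hε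
    have h1 := hm (max m N) (le_max_left _ _) _ (hmeas.inter hC.measurableSet)
    have hC' := hC.mono (le_max_right m N)
    rw [← hcyl hC']
    have h2 : 1 / 2 * Q C (max m N) ≤ Q (G.ev x ∩ C) (max m N) := by
      have e : 1 / 2 * Q C (max m N) = (τ.op ^ (max m N)) ((1 / 2 : ℝ) • planProb π C) [] v := by
        rw [map_smul]; rfl
      rw [e]
      refine Strategy.op_pow_mono _ hInv _ (N := 0) (fun h v hI hl => ?_) [] v hW rfl
      have hinter : tls h (G.ev x ∩ C) = tls h (G.ev x) ∩ tls h C := by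
        clear hI hl
        induction h with
        | nil => rfl
        | cons e h ih => rw [tls, ih]; rfl
      simp only [Pi.smul_apply, smul_eq_mul, planProb, hinter]
      rcases hC'.tls_eq (h := h) (by omega) with h' | h'
      · have := (hsafe h v hI).2
        rw [planProb] at this
        simp only [h', prob_univ, Set.inter_univ]
        linarith
      · simp [h']
    linarith [(abs_le.1 h1).1]
  have hzero : prob τ v (G.ev x)ᶜ ≤ 0 := by
    refine le_of_forall_pos_le_add fun ε hε => ?_
    obtain ⟨N, C, hC, hlt⟩ := exists_isCylAt_approx (M.law τ v) hmeas.compl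
      (show 0 < ε / 3 by positivity)
    have h1 := hhalf hC
    have h2 : prob τ v (G.ev x ∩ C) ≤ (M.law τ v).real (symmDiff C (G.ev x)ᶜ) :=
      measureReal_mono (fun ω hω => Or.inl ⟨hω.2, fun h => h hω.1⟩)
    have h3 : |prob τ v C - prob τ v (G.ev x)ᶜ| ≤ _ :=
      abs_measureReal_sub_le_measureReal_symmDiff hC.measurableSet.nullMeasurableSet
        hmeas.compl.nullMeasurableSet
    have := (abs_le.1 (h3.trans hlt.le)).1
    linarith
  have : prob τ v (G.ev x)ᶜ = 1 - prob τ v (G.ev x) := probReal_compl_eq_one_sub hmeas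
  have := prob_le_one τ v (G.ev x)
  linarith

end MDP

namespace MDP

open Cyl Filter Topology

/-! ### Optimal memoryless choices for weighted objectives -/

/-- Existence of a solution to an optimality equation with a contracting right-hand side. -/
lemma exists_optimality_equation {Y Ch : Type*} [Fintype Y] (valid : Y → Finset Ch)
    (hv : ∀ y, (valid y).Nonempty) (L : Y → Ch → (Y → ℝ) → ℝ) {c : ℝ} (hc0 : 0 ≤ c) (hc1 : c < 1)
    (hL : ∀ y ch, ch ∈ valid y → ∀ f g K, 0 ≤ K → (∀ y, f y ≤ g y + K) →
      L y ch f ≤ L y ch g + c * K) :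
    ∃ f : Y → ℝ, ∀ y, (∀ ch ∈ valid y, L y ch f ≤ f y) ∧ ∃ ch ∈ valid y, f y = L y ch f := by
  let B : (Y → ℝ) → Y → ℝ := fun f y => (valid y).sup' (hv y) fun ch => L y ch f
  have hB : ∀ f g y, B f y ≤ B g y + c * dist f g := by
    intro f g y
    refine Finset.sup'_le _ _ fun ch hch => ?_
    have h1 := hL y ch hch f g (dist f g) dist_nonneg fun y => by
      have := (le_abs_self _).trans (dist_le_pi_dist f g y)
      linarith
    have h2 := Finset.le_sup' (fun ch => L y ch g) hch
    simp only [B]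
    linarith
  have hcontr : ContractingWith ⟨c, hc0⟩ B := by
    refine ⟨by exact_mod_cast hc1, LipschitzWith.of_dist_le_mul fun f g => ?_⟩
    refine (dist_pi_le_iff (mul_nonneg hc0 dist_nonneg)).2 fun y => ?_
    rw [Real.dist_eq, abs_le]
    have h1 := hB f g y
    have h2 := hB g f y
    rw [dist_comm g f] at h2
    change -(c * dist f g) ≤ _ ∧ _ ≤ c * dist f g
    constructor <;> linarith
  have hfix : B hcontr.fixedPoint = hcontr.fixedPoint := hcontr.fixedPoint_isFixedPt
  refine ⟨hcontr.fixedPoint, fun y => ⟨fun ch hch => ?_, ?_⟩⟩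
  · nth_rw 2 [← hfix]
    exact Finset.le_sup' (fun ch => L y ch hcontr.fixedPoint) hch
  · obtain ⟨ch, h1, h2⟩ := Finset.exists_mem_eq_sup' (hv y) fun ch => L y ch hcontr.fixedPoint
    refine ⟨ch, h1, ?_⟩
    rw [← h2]
    exact (congrFun hfix y).symm

variable {V A X C : Type} [Fintype V] [Fintype A] {M : MDP V A}

/-- The point distribution at the action `a`, or at some enabled action if `a` is not enabled. -/
noncomputable def pureAct [DecidableEq A] (M : MDP V A) (v : V) (a b : A) : ℝ :=
  if b = (if a ∈ M.enabled v then a else (M.enabled_nonempty v).choose) then 1 else 0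

/-- The strategy in force after a history, when each pair of a state and a memory content
prescribes an action or the switch to one of the strategies `σ`. -/
noncomputable def inForce (upd : X → V → X) (σ : C → V → X → M.Strategy) (π : V → X → A ⊕ C)
    (x : X) : List (V × A) → V → Option M.Strategy
  | [], v => (π v x).elim (fun _ => none) fun c => some (σ c v x)
  | e :: h, v => ((inForce upd σ π x h e.1).map fun τ => τ.shift [e]).orElse fun _ =>
      (π v (memo upd x (e :: h))).elim (fun _ => none) fun c => some (σ c v (memo upd x (e :: h)))

lemma memo_append (upd : X → V → X) (x : X) (h : List (V × A)) (e : V × A) :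
    memo upd x (h ++ [e]) = memo upd (upd x e.1) h := by
  induction h with
  | nil => rfl
  | cons e' h ih => simp only [List.cons_append, memo, ih]

lemma inForce_append_of_inl (upd : X → V → X) (σ : C → V → X → M.Strategy) (π : V → X → A ⊕ C)
    (x : X) (e : V × A) {a : A} (ha : π e.1 x = Sum.inl a) (h : List (V × A)) (v : V) :
    inForce upd σ π x (h ++ [e]) v = inForce upd σ π (upd x e.1) h v := by
  induction h generalizing v with
  | nil => simp [inForce, ha, memo]
  | cons e' h ih =>
    simp only [List.cons_append, inForce, ih, memo, memo_append]

lemma inForce_append_of_inr (upd : X → V → X) (σ : C → V → X → M.Strategy) (π : V → X → A ⊕ C)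
    (x : X) (e : V × A) {c : C} (hc : π e.1 x = Sum.inr c) (h : List (V × A)) (v : V) :
    inForce upd σ π x (h ++ [e]) v = some ((σ c e.1 x).shift (h ++ [e])) := by
  induction h generalizing v with
  | nil => simp [inForce, hc]
  | cons e' h ih => simp [inForce, ih, Strategy.shift_shift]

/-- The strategy determined by the choices `π`. -/
noncomputable def choiceStrategy [DecidableEq A] (upd : X → V → X) (σ : C → V → X → M.Strategy)
    (π : V → X → A ⊕ C) (x : X) : M.Strategy where
  act h v := (inForce upd σ π x h v).elim
    (M.pureAct v ((π v (memo upd x h)).elim id fun _ => (M.enabled_nonempty v).choose))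
    fun τ => τ.act [] v
  act_nonneg h v a := by
    cases inForce upd σ π x h v with
    | none => simp only [Option.elim, pureAct]; split_ifs <;> norm_num
    | some τ => exact τ.act_nonneg [] v a
  act_support h v a ha := by
    cases inForce upd σ π x h v with
    | none =>
      simp only [Option.elim, pureAct]
      rw [if_neg]
      rintro rfl
      split_ifs at ha with h
      · exact ha h
      · exact ha (M.enabled_nonempty v).choose_spec
    | some τ => exact τ.act_support [] v a ha
  act_sum h v := by
    cases inForce upd σ π x h v with
    | none => simp [Option.elim, pureAct]
    | some τ => exact τ.act_sum [] v

lemma choiceStrategy_shift_of_inl [DecidableEq A] (upd : X → V → X) (σ : C → V → X → M.Strategy)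
    (π : V → X → A ⊕ C) (x : X) (e : V × A) {a : A} (ha : π e.1 x = Sum.inl a) :
    (choiceStrategy upd σ π x).shift [e] = choiceStrategy upd σ π (upd x e.1) :=
  Strategy.ext_act fun l v b => by
    simp only [Strategy.shift, choiceStrategy, inForce_append_of_inl upd σ π x e ha, memo_append]

lemma choiceStrategy_shift_of_inr [DecidableEq A] (upd : X → V → X) (σ : C → V → X → M.Strategy)
    (π : V → X → A ⊕ C) (x : X) (e : V × A) {c : C} (hc : π e.1 x = Sum.inr c) :
    (choiceStrategy upd σ π x).shift [e] = (σ c e.1 x).shift [e] :=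
  Strategy.ext_act fun l v b => by
    simp [Strategy.shift, choiceStrategy, inForce_append_of_inr upd σ π x e hc]

variable [DecidableEq V] [Nonempty V] [Nonempty A] [MeasurableSpace V] [DiscreteMeasurableSpace V]
  [MeasurableSpace A] [DiscreteMeasurableSpace A] {upd : X → V → X}

lemma prob_choiceStrategy_of_inl [DecidableEq A] (G : Tracked A upd)
    (σ : C → V → X → M.Strategy) (π : V → X → A ⊕ C) (x : X) (v : V) {a : A}
    (ha : π v x = Sum.inl a) (hae : a ∈ M.enabled v) :
    prob (choiceStrategy upd σ π x) v (G.ev x) = ∑ v', M.p v a v' *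
      prob (choiceStrategy upd σ π (upd x v)) v' (G.ev (upd x v)) := by
  have h : ∀ b, (choiceStrategy upd σ π x).act [] v b = if b = a then 1 else 0 := fun b => by
    simp [choiceStrategy, inForce, ha, memo, pureAct, hae]
  rw [prob_eq_sum _ _ (G.measurableSet_ev x)]
  simp only [h, ite_mul, one_mul, zero_mul, Finset.sum_ite_eq', Finset.mem_univ, if_true]
  simp only [choiceStrategy_shift_of_inl upd σ π x (v, a) ha, G.tl_ev]

lemma prob_choiceStrategy_of_inr [DecidableEq A] (G : Tracked A upd)
    (σ : C → V → X → M.Strategy) (π : V → X → A ⊕ C) (x : X) (v : V) {c : C}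
    (hc : π v x = Sum.inr c) :
    prob (choiceStrategy upd σ π x) v (G.ev x) = prob (σ c v x) v (G.ev x) := by
  have h : ∀ b, (choiceStrategy upd σ π x).act [] v b = (σ c v x).act [] v b := fun b => by
    simp [choiceStrategy, inForce, hc]
  rw [prob_eq_sum _ _ (G.measurableSet_ev x), prob_eq_sum (σ c v x) _ (G.measurableSet_ev x)]
  simp only [h, choiceStrategy_shift_of_inr upd σ π x (v, _) hc]

lemma exists_gap_of_not_almostSure [Finite X] [Finite C] (M : MDP V A) (O : C → Tracked A upd) :
    ∃ η > 0, η ≤ 1 ∧ ∀ c v x, (¬ ∃ σ : M.Strategy, prob σ v ((O c).ev x) = 1) →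
      ∀ σ : M.Strategy, prob σ v ((O c).ev x) ≤ 1 - η := by
  have := exists_forall_of_antitone (ι := C × V × X) (P := fun i η =>
    (¬ ∃ σ : M.Strategy, prob σ i.2.1 ((O i.1).ev i.2.2) = 1) →
      ∀ σ : M.Strategy, prob σ i.2.1 ((O i.1).ev i.2.2) ≤ 1 - η) ?_ ?_
  · obtain ⟨η, h0, h1, h⟩ := this
    exact ⟨η, h0, h1, fun c v x => h (c, v, x)⟩
  · rintro ⟨c, v, x⟩
    by_cases h : LimitSure M (O c) v x
    · exact ⟨1, one_pos, fun h' => absurd (exists_prob_eq_one_of_limitSure _ h) h'⟩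
    · simp only [LimitSure, not_forall, not_exists, not_lt, exists_prop] at h
      obtain ⟨ε, hε, h⟩ := h
      exact ⟨ε, hε, fun _ => h⟩
  · exact fun i ε ε' hε h h1 σ => (h h1 σ).trans (by linarith)

/-- The expected weight. -/
noncomputable def wval [Fintype C] (O : C → Tracked A upd) (w : C → ℝ) (σ : M.Strategy)
    (v : V) (x : X) : ℝ := ∑ c, w c * prob σ v ((O c).ev x)

lemma wval_nonneg [Fintype C] (O : C → Tracked A upd) {w : C → ℝ} (hw : ∀ c, 0 ≤ w c)
    (σ : M.Strategy) (v : V) (x : X) : 0 ≤ wval O w σ v x :=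
  Finset.sum_nonneg fun c _ => mul_nonneg (hw c) (prob_nonneg _ _ _)

lemma sum_prob_eq_one [Fintype C] (O : C → Tracked A upd)
    (hO : ∀ x ω, ∃! c, ω ∈ (O c).ev x) (σ : M.Strategy) (v : V) (x : X) :
    ∑ c, prob σ v ((O c).ev x) = 1 := by
  have hd : Set.PairwiseDisjoint (↑(Finset.univ : Finset C)) fun c => (O c).ev x :=
    fun c _ c' _ hne => Set.disjoint_left.2 fun ω h h' => hne ((hO x ω).unique h h')
  have h := measureReal_biUnion_finset (μ := M.law σ v) hd fun c _ => (O c).measurableSet_ev x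
  simp only [prob]
  rw [← h]
  have : ⋃ c ∈ (Finset.univ : Finset C), (O c).ev x = Set.univ :=
    Set.eq_univ_of_forall fun ω => by
      obtain ⟨c, hc, -⟩ := hO x ω
      simpa using ⟨c, hc⟩
  rw [this, probReal_univ]

lemma wval_le_of_prob [Fintype C] (O : C → Tracked A upd) (hO : ∀ x ω, ∃! c, ω ∈ (O c).ev x)
    {w : C → ℝ} (hw : ∀ c, 0 ≤ w c) (σ : M.Strategy) (v : V) (x : X) (c : C) :
    wval O w σ v x ≤ w c + (∑ c, w c) * (1 - prob σ v ((O c).ev x)) := by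
  classical
  have h1 := sum_prob_eq_one O hO σ v x
  rw [wval, ← Finset.add_sum_erase _ _ (Finset.mem_univ c)]
  rw [← Finset.add_sum_erase _ _ (Finset.mem_univ c)] at h1
  refine add_le_add (mul_le_of_le_one_right (hw c) (prob_le_one _ _ _)) ?_
  rw [← h1, add_sub_cancel_left, Finset.mul_sum]
  refine Finset.sum_le_sum fun c' _ => mul_le_mul_of_nonneg_right ?_ (prob_nonneg _ _ _)
  exact Finset.single_le_sum (fun c _ => hw c) (Finset.mem_univ c')

lemma wval_le_sum [Fintype C] (O : C → Tracked A upd)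
    {w : C → ℝ} (hw : ∀ c, 0 ≤ w c) (σ : M.Strategy) (v : V) (x : X) :
    wval O w σ v x ≤ ∑ c, w c :=
  Finset.sum_le_sum fun c _ => mul_le_of_le_one_right (hw c) (prob_le_one _ _ _)

end MDP

namespace MDP

open Cyl Filter Topology

variable {V A X C : Type} [Fintype V] [Fintype A] {M : MDP V A}

/-- A nonnegative solution of the discounted optimality equation for stopping with the weight `w c`
where `D c` holds, together with optimal choices. -/
lemma exists_discounted_value [Finite X] [Finite C] [Nonempty V] (M : MDP V A) (upd : X → V → X)
    (D : C → V → X → Prop) (w : C → ℝ) {lam : ℝ} (h0 : 0 ≤ lam) (h1 : lam < 1) :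
    ∃ f : V → X → ℝ, (∀ v x, 0 ≤ f v x) ∧
      (∀ v x, ∀ a ∈ M.enabled v, lam * ∑ v', M.p v a v' * f v' (upd x v) ≤ f v x) ∧
      (∀ v x c, D c v x → w c ≤ f v x) ∧
      ∃ π : V → X → A ⊕ C, ∀ v x,
        (∃ a ∈ M.enabled v, π v x = Sum.inl a ∧
          f v x = lam * ∑ v', M.p v a v' * f v' (upd x v)) ∨
        ∃ c, D c v x ∧ π v x = Sum.inr c ∧ f v x = w c := by
  classical
  have := Fintype.ofFinite X
  have := Fintype.ofFinite C
  let valid : V × X → Finset (A ⊕ C) := fun y =>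
    (M.enabled y.1).disjSum (Finset.univ.filter fun c => D c y.1 y.2)
  let L : V × X → A ⊕ C → (V × X → ℝ) → ℝ := fun y ch f =>
    ch.elim (fun a => lam * ∑ v', M.p y.1 a v' * f (v', upd y.2 y.1)) w
  have hv : ∀ y, (valid y).Nonempty := fun y =>
    ⟨Sum.inl (M.enabled_nonempty y.1).choose,
      Finset.inl_mem_disjSum.2 (M.enabled_nonempty y.1).choose_spec⟩
  have hL : ∀ y ch, ch ∈ valid y → ∀ f g K, 0 ≤ K → (∀ y, f y ≤ g y + K) →
      L y ch f ≤ L y ch g + lam * K := by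
    rintro ⟨v, x⟩ (a | c) hch f g K hK hfg
    · have ha : a ∈ M.enabled v := Finset.inl_mem_disjSum.1 hch
      simp only [L, Sum.elim_inl]
      rw [← mul_add]
      refine mul_le_mul_of_nonneg_left ?_ h0
      calc ∑ v', M.p v a v' * f (v', upd x v)
          ≤ ∑ v', M.p v a v' * (g (v', upd x v) + K) := Finset.sum_le_sum fun v' _ =>
            mul_le_mul_of_nonneg_left (hfg _) (M.p_nonneg _ _ _)
        _ = _ := by
          simp only [mul_add, Finset.sum_add_distrib, ← Finset.sum_mul, M.p_sum v a ha, one_mul]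
    · simp only [L, Sum.elim_inr]
      linarith [mul_nonneg h0 hK]
  obtain ⟨f, hf⟩ := exists_optimality_equation valid hv L h0 h1 hL
  have hact : ∀ v x, ∀ a ∈ M.enabled v,
      lam * ∑ v', M.p v a v' * f (v', upd x v) ≤ f (v, x) := fun v x a ha =>
    (hf (v, x)).1 (Sum.inl a) (Finset.inl_mem_disjSum.2 ha)
  have hnn : ∀ y, 0 ≤ f y := by
    intro y
    have : Nonempty (V × X) := ⟨y⟩
    obtain ⟨⟨v, x⟩, hy⟩ := Finite.exists_min f
    refine le_trans ?_ (hy y)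
    obtain ⟨a, ha⟩ := M.enabled_nonempty v
    have h2 : f (v, x) ≤ ∑ v', M.p v a v' * f (v', upd x v) := by
      calc f (v, x) = ∑ v', M.p v a v' * f (v, x) := by
            rw [← Finset.sum_mul, M.p_sum v a ha, one_mul]
        _ ≤ _ := Finset.sum_le_sum fun v' _ =>
            mul_le_mul_of_nonneg_left (hy _) (M.p_nonneg _ _ _)
    have h3 := mul_le_mul_of_nonneg_left h2 h0
    have h4 := hact v x a ha
    nlinarith
  choose π hπ hπf using fun y => (hf y).2
  refine ⟨fun v x => f (v, x), fun v x => hnn _, hact, fun v x c hc =>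
    (hf (v, x)).1 (Sum.inr c) (Finset.inr_mem_disjSum.2 (by simpa using hc)),
    fun v x => π (v, x), fun v x => ?_⟩
  have e1 := hπ (v, x)
  have e2 := hπf (v, x)
  rcases h : π (v, x) with a | c
  · rw [h] at e1 e2
    exact Or.inl ⟨a, Finset.inl_mem_disjSum.1 e1, h, e2⟩
  · rw [h] at e1 e2
    exact Or.inr ⟨c, by simpa using Finset.inr_mem_disjSum.1 e1, h, e2⟩

variable [DecidableEq V] [Nonempty V] [Nonempty A] [MeasurableSpace V] [DiscreteMeasurableSpace V]
  [MeasurableSpace A] [DiscreteMeasurableSpace A] {upd : X → V → X}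

lemma le_wval_choiceStrategy [Finite X] [Fintype C] [DecidableEq A] (O : C → Tracked A upd)
    (hO : ∀ x ω, ∃! c, ω ∈ (O c).ev x) {w : C → ℝ} (hw : ∀ c, 0 ≤ w c)
    {D : C → V → X → Prop} {σD : C → V → X → M.Strategy}
    (hσD : ∀ c v x, D c v x → prob (σD c v x) v ((O c).ev x) = 1)
    {lam : ℝ} (h0 : 0 ≤ lam) (h1 : lam < 1) {f : V → X → ℝ} {π : V → X → A ⊕ C}
    (hπ : ∀ v x, (∃ a ∈ M.enabled v, π v x = Sum.inl a ∧
        f v x = lam * ∑ v', M.p v a v' * f v' (upd x v)) ∨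
      ∃ c, D c v x ∧ π v x = Sum.inr c ∧ f v x = w c) (v : V) (x : X) :
    f v x ≤ wval O w (choiceStrategy upd σD π x) v x := by
  classical
  set q : V → X → ℝ := fun v x => wval O w (choiceStrategy upd σD π x) v x with hq
  suffices h : ∀ y : V × X, 0 ≤ q y.1 y.2 - f y.1 y.2 from sub_nonneg.1 (h (v, x))
  intro y
  have : Nonempty (V × X) := ⟨y⟩
  obtain ⟨⟨v, x⟩, hy⟩ := Finite.exists_min fun y : V × X => q y.1 y.2 - f y.1 y.2
  refine le_trans ?_ (hy y)
  dsimp only at hy ⊢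
  rcases hπ v x with ⟨a, ha, hπa, hf⟩ | ⟨c, hD, hπc, hf⟩
  · have hqs : q v x = ∑ v', M.p v a v' * q v' (upd x v) := by
      simp only [hq, wval, prob_choiceStrategy_of_inl _ σD π x v hπa ha, Finset.mul_sum]
      rw [Finset.sum_comm]
      refine Finset.sum_congr rfl fun v' _ => Finset.sum_congr rfl fun c _ => ?_
      ring
    have hq0 : 0 ≤ q v x := wval_nonneg O hw _ _ _
    have h2 : q v x - f v x ≤ ∑ v', M.p v a v' * (q v' (upd x v) - f v' (upd x v)) := by
      calc q v x - f v x = ∑ v', M.p v a v' * (q v x - f v x) := by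
            rw [← Finset.sum_mul, M.p_sum v a ha, one_mul]
        _ ≤ _ := Finset.sum_le_sum fun v' _ =>
            mul_le_mul_of_nonneg_left (hy (v', upd x v)) (M.p_nonneg _ _ _)
    simp only [mul_sub, Finset.sum_sub_distrib, ← hqs] at h2
    have h3 := mul_le_mul_of_nonneg_left h2 h0
    rw [mul_sub lam, mul_sub lam, ← hf] at h3
    nlinarith
  · have h2 := sum_prob_eq_one O hO (σD c v x) v x
    have hz : ∀ c' ≠ c, prob (σD c v x) v ((O c').ev x) = 0 := by
      rw [← Finset.add_sum_erase _ _ (Finset.mem_univ c), hσD c v x hD] at h2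
      intro c' hc'
      exact (Finset.sum_eq_zero_iff_of_nonneg (s := Finset.univ.erase c)
        (f := fun c' => prob (σD c v x) v ((O c').ev x)) fun _ _ => prob_nonneg _ _ _).1
        (by linarith) c' (by simp [hc'])
    have : q v x = w c := by
      simp only [hq, wval, prob_choiceStrategy_of_inr _ σD π x v hπc]
      rw [Finset.sum_eq_single c (fun c' _ h => by rw [hz c' h, mul_zero]) (by simp),
        hσD c v x hD, mul_one]
    rw [this, hf, sub_self]

lemma pow_mul_op_pow_le (σ : M.Strategy) {lam : ℝ} (h0 : 0 ≤ lam) {f : V → X → ℝ}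
    (hf : ∀ v x, ∀ a ∈ M.enabled v, lam * ∑ v', M.p v a v' * f v' (upd x v) ≤ f v x)
    (x : X) (n : ℕ) (v : V) :
    lam ^ n * (σ.op ^ n) (fun h v => f v (memo upd x h)) [] v ≤ f v x := by
  suffices h : ∀ h v, lam ^ n * (σ.op ^ n) (fun h v => f v (memo upd x h)) h v ≤
      f v (memo upd x h) from h [] v
  induction n with
  | zero => simp
  | succ n ih =>
    intro h v
    rw [pow_succ', pow_succ' σ.op, Module.End.mul_apply, Strategy.op_apply, mul_assoc]
    have h3 : ∀ a, σ.act h v a * (lam * ∑ v', M.p v a v' * (lam ^ n *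
        (σ.op ^ n) (fun h v => f v (memo upd x h)) ((v, a) :: h) v')) ≤
        σ.act h v a * f v (memo upd x h) := by
      intro a
      by_cases ha : a ∈ M.enabled v
      · refine mul_le_mul_of_nonneg_left ?_ (σ.act_nonneg _ _ _)
        refine le_trans (mul_le_mul_of_nonneg_left ?_ h0) (hf v _ a ha)
        exact Finset.sum_le_sum fun v' _ =>
          mul_le_mul_of_nonneg_left (ih ((v, a) :: h) v') (M.p_nonneg _ _ _)
      · simp [σ.act_support h v a ha]
    calc _ = ∑ a, σ.act h v a * (lam * ∑ v', M.p v a v' * (lam ^ n *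
        (σ.op ^ n) (fun h v => f v (memo upd x h)) ((v, a) :: h) v')) := by
          simp only [Finset.mul_sum]
          refine Finset.sum_congr rfl fun a _ => Finset.sum_congr rfl fun v' _ => ?_
          ring
      _ ≤ ∑ a, σ.act h v a * f v (memo upd x h) := Finset.sum_le_sum fun a _ => h3 a
      _ = _ := by rw [← Finset.sum_mul, σ.act_sum, one_mul]

lemma tls_symmDiff {E : Type} (h : List E) (s t : Set (ℕ → E)) :
    tls h (symmDiff s t) = symmDiff (tls h s) (tls h t) := by
  induction h with
  | nil => rfl
  | cons e h ih => rw [tls, ih]; rfl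

/-- After a history deciding finite-horizon approximations of the objectives, the expected weight
exceeds the best available stopping weight by at most a multiple of the approximation error. -/
lemma wval_shift_le [Fintype C] (O : C → Tracked A upd) (hO : ∀ x ω, ∃! c, ω ∈ (O c).ev x)
    {w : C → ℝ} (hw : ∀ c, 0 ≤ w c) {η : ℝ} (hη : 0 < η) (hη1 : η ≤ 1)
    {D : C → V → X → Prop} (hgap : ∀ c v x, ¬ D c v x → ∀ σ : M.Strategy,
      prob σ v ((O c).ev x) ≤ 1 - η)
    {f : V → X → ℝ} (hf0 : ∀ v x, 0 ≤ f v x) (hfD : ∀ v x c, D c v x → w c ≤ f v x)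
    (σ : M.Strategy) (x : X) {n : ℕ} {Cy : C → Set (ℕ → V × A)} (hC : ∀ c, IsCylAt n (Cy c))
    {h : List (V × A)} (hn : n ≤ h.length) (v : V) :
    wval O w (σ.shift h) v (memo upd x h) ≤ f v (memo upd x h) +
      (∑ c, w c) / η * ∑ c, condProb σ (symmDiff (Cy c) ((O c).ev x)) h v := by
  set S := ∑ c, condProb σ (symmDiff (Cy c) ((O c).ev x)) h v with hS
  set W := ∑ c, w c with hW
  have hW0 : 0 ≤ W := Finset.sum_nonneg fun c _ => hw c
  have hSge : ∀ c, condProb σ (symmDiff (Cy c) ((O c).ev x)) h v ≤ S := fun c =>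
    Finset.single_le_sum (f := fun c => condProb σ (symmDiff (Cy c) ((O c).ev x)) h v)
      (fun _ _ => prob_nonneg _ _ _) (Finset.mem_univ c)
  have hS0 : 0 ≤ S := Finset.sum_nonneg fun c _ => prob_nonneg _ _ _
  have hcase : η ≤ S → wval O w (σ.shift h) v (memo upd x h) ≤ f v (memo upd x h) + W / η * S := by
    intro hle
    have h1 := wval_le_sum O hw (σ.shift h) v (memo upd x h)
    have h2 : W ≤ W / η * S := by
      rw [div_mul_eq_mul_div, le_div_iff₀ hη]
      exact mul_le_mul_of_nonneg_left hle hW0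
    linarith [hf0 v (memo upd x h)]
  have hev : ∀ c, condProb σ (symmDiff (Cy c) ((O c).ev x)) h v =
      prob (σ.shift h) v (symmDiff (tls h (Cy c)) ((O c).ev (memo upd x h))) := fun c => by
    rw [condProb, tls_symmDiff, Tracked.tls_ev]
  by_cases hex : ∃ c, tls h (Cy c) = Set.univ
  · obtain ⟨c, hc⟩ := hex
    have h1 : condProb σ (symmDiff (Cy c) ((O c).ev x)) h v =
        1 - prob (σ.shift h) v ((O c).ev (memo upd x h)) := by
      rw [hev, hc]
      have : symmDiff Set.univ ((O c).ev (memo upd x h)) = ((O c).ev (memo upd x h))ᶜ := by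
        rw [← Set.top_eq_univ, top_symmDiff]
        simp
      rw [this, prob, probReal_compl_eq_one_sub ((O c).measurableSet_ev _)]
      rfl
    have h2 := hSge c
    by_cases hD : D c v (memo upd x h)
    · have h3 := wval_le_of_prob O hO hw (σ.shift h) v (memo upd x h) c
      have h4 := hfD _ _ _ hD
      have h5 : W * (1 - prob (σ.shift h) v ((O c).ev (memo upd x h))) ≤ W / η * S := by
        rw [← h1, div_mul_eq_mul_div, le_div_iff₀ hη, mul_assoc]
        refine mul_le_mul_of_nonneg_left ?_ hW0
        have := prob_nonneg (σ.shift h) v (tls h (symmDiff (Cy c) ((O c).ev x)))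
        change 0 ≤ condProb σ (symmDiff (Cy c) ((O c).ev x)) h v at this
        nlinarith
      linarith
    · exact hcase (by linarith [hgap c v _ hD (σ.shift h)])
  · push Not at hex
    refine hcase (hη1.trans ?_)
    rw [← sum_prob_eq_one O hO (σ.shift h) v (memo upd x h), hS]
    refine Finset.sum_le_sum fun c _ => ?_
    rw [hev, ((hC c).tls_eq hn).resolve_left (hex c), ← Set.bot_eq_empty, bot_symmDiff]

/-- Finitely many strategies suffice to maximize all the nonnegative weightings of objectives
partitioning the runs. -/
theorem exists_finite_optimal [Finite X] [Fintype C] (M : MDP V A) (O : C → Tracked A upd)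
    (hO : ∀ x ω, ∃! c, ω ∈ (O c).ev x) (v : V) (x : X) :
    ∃ T : Set M.Strategy, T.Finite ∧ T.Nonempty ∧ ∀ w : C → ℝ, (∀ c, 0 ≤ w c) →
      ∃ τ ∈ T, ∀ σ : M.Strategy, wval O w σ v x ≤ wval O w τ v x := by
  classical
  let D : C → V → X → Prop := fun c v x => ∃ σ : M.Strategy, prob σ v ((O c).ev x) = 1
  obtain ⟨η, hη, hη1, hgap⟩ := exists_gap_of_not_almostSure M O
  have hne : Nonempty M.Strategy :=
    ⟨⟨fun _ v => M.pureAct v (M.enabled_nonempty v).choose, fun _ v a => by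
      simp only [pureAct]; split_ifs <;> norm_num, fun _ v a ha => by
      simp only [pureAct, (M.enabled_nonempty v).choose_spec, if_true]
      rw [if_neg]
      rintro rfl
      exact ha (M.enabled_nonempty v).choose_spec, fun _ v => by simp [pureAct]⟩⟩
  let σD : C → V → X → M.Strategy := fun c v x =>
    if h : D c v x then h.choose else Classical.choice hne
  have hσD : ∀ c v x, D c v x → prob (σD c v x) v ((O c).ev x) = 1 := fun c v x h => by
    simp only [σD, dif_pos h]
    exact h.choose_spec
  let T : Set M.Strategy := Set.range fun π : V → X → A ⊕ C => choiceStrategy upd σD π x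
  have hT : T.Finite := Set.finite_range _
  have hTne : T.Nonempty := ⟨_, fun _ _ => Sum.inl (Classical.arbitrary A), rfl⟩
  refine ⟨T, hT, hTne, fun w hw => ?_⟩
  obtain ⟨τ, hτ, hmax⟩ := hT.exists_maximalFor (fun τ => wval O w τ v x) T hTne
  have hmax' : ∀ τ' ∈ T, wval O w τ' v x ≤ wval O w τ v x := fun τ' h' => by
    rcases le_total (wval O w τ' v x) (wval O w τ v x) with h | h
    · exact h
    · exact hmax h' h
  refine ⟨τ, hτ, fun σ => ?_⟩
  set m := wval O w τ v x
  set W := ∑ c, w c with hW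
  have hW0 : 0 ≤ W := Finset.sum_nonneg fun c _ => hw c
  set N : ℝ := (Fintype.card C : ℝ)
  refine le_of_forall_pos_le_add fun ε hε => ?_
  let δ : ℝ := ε / (W / η * N + 1)
  have hK : 0 ≤ W / η * N := by positivity
  have hδ : 0 < δ := by positivity
  choose nc Cy hCy happ using fun c =>
    exists_isCylAt_approx (M.law σ v) ((O c).measurableSet_ev x) hδ
  let n := Finset.univ.sup nc
  have hC : ∀ c, IsCylAt n (Cy c) := fun c => (hCy c).mono (Finset.le_sup (Finset.mem_univ c))
  have hmeas : ∀ c, MeasurableSet (symmDiff (Cy c) ((O c).ev x)) := fun c =>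
    (hC c).measurableSet.symmDiff ((O c).measurableSet_ev x)
  have hval : (σ.op ^ n) (fun h v => wval O w (σ.shift h) v (memo upd x h)) = fun h v =>
      wval O w (σ.shift h) v (memo upd x h) := by
    have : (fun h v => wval O w (σ.shift h) v (memo upd x h)) =
        ∑ c, w c • condProb σ ((O c).ev x) := by
      ext h v
      simp only [wval, condProb, Finset.sum_apply, Pi.smul_apply, smul_eq_mul, Tracked.tls_ev]
    rw [this, map_sum]
    refine Finset.sum_congr rfl fun c _ => ?_
    rw [map_smul, op_pow_condProb _ ((O c).measurableSet_ev x)]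
  have hbound : ∀ lam : ℝ, 0 ≤ lam → lam < 1 → lam ^ n * wval O w σ v x ≤ m + ε := by
    intro lam h0 h1
    obtain ⟨f, hf0, hfa, hfD, π, hπ⟩ := exists_discounted_value M upd D w h0 h1
    have hfm : f v x ≤ m := (le_wval_choiceStrategy O hO hw hσD h0 h1 hπ v x).trans
      (hmax' _ ⟨π, rfl⟩)
    have h2 := Strategy.op_pow_mono σ (I := fun _ _ => True) (fun _ _ _ _ _ _ _ => trivial) n
      (N := 0) (Φ' := (fun h v => f v (memo upd x h)) +
        (W / η) • ∑ c, condProb σ (symmDiff (Cy c) ((O c).ev x)))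
      (fun h v _ hl => by
        have := wval_shift_le O hO hw hη hη1 (fun c v x h => hgap c v x h) hf0 hfD σ x hC
          (h := h) (by omega) v
        simpa only [Pi.add_apply, Pi.smul_apply, Finset.sum_apply, smul_eq_mul] using this)
      [] v trivial rfl
    rw [hval, map_add, map_smul, map_sum] at h2
    simp only [op_pow_condProb σ (hmeas _), Pi.add_apply, Pi.smul_apply, Finset.sum_apply,
      smul_eq_mul, condProb_nil, Strategy.shift_nil, memo] at h2
    have h3 : W / η * ∑ c, prob σ v (symmDiff (Cy c) ((O c).ev x)) ≤ ε := by
      calc _ ≤ W / η * (N * δ) := by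
            refine mul_le_mul_of_nonneg_left ?_ (by positivity)
            rw [← nsmul_eq_mul, ← Finset.card_univ, ← Finset.sum_const]
            exact Finset.sum_le_sum fun c _ => (happ c).le
        _ = (W / η * N) / (W / η * N + 1) * ε := by simp only [δ]; ring
        _ ≤ 1 * ε := mul_le_mul_of_nonneg_right
            ((div_le_one (by positivity)).2 (by linarith)) hε.le
        _ = ε := one_mul ε
    have h4 := pow_mul_op_pow_le σ h0 hfa x n v
    have h5 : lam ^ n ≤ 1 := pow_le_one₀ h0 h1.le
    have h6 : 0 ≤ lam ^ n := pow_nonneg h0 n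
    have h7 := mul_le_mul_of_nonneg_left (h2.trans (by gcongr)) h6
    rw [mul_add] at h7
    nlinarith
  have hlim : Tendsto (fun lam : ℝ => lam ^ n * wval O w σ v x) (𝓝[<] 1)
      (𝓝 (1 ^ n * wval O w σ v x)) :=
    (((continuous_id.pow n).mul continuous_const).tendsto 1).mono_left nhdsWithin_le_nhds
  rw [one_pow, one_mul] at hlim
  refine le_of_tendsto hlim ?_
  filter_upwards [Ioo_mem_nhdsLT (show (0 : ℝ) < 1 from one_pos)] with lam hl
  exact hbound lam hl.1.le hl.2

end MDP

/-! ### Measurability of ω-regular languages -/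

namespace NBA

open Filter

/-- A sequence of cut points whose consecutive pairs, but possibly the first one, have a common
colour. -/
lemma exists_homogeneous_cuts {T : Type*} [Finite T] (c : ℕ → ℕ → T) :
    ∃ ψ : ℕ → ℕ, StrictMono ψ ∧ ψ 0 = 0 ∧ ∃ e, ∀ i, c (ψ (i + 1)) (ψ (i + 2)) = e := by
  obtain ⟨d, hd⟩ : ∃ d : ℕ → T, ∀ i, ∀ᶠ j in hyperfilter ℕ, c i j = d i := by
    have : ∀ i, ∃ e, ∀ᶠ j in hyperfilter ℕ, c i j = e := fun i =>
      Ultrafilter.eventually_exists_iff.1 (Eventually.of_forall fun j => ⟨c i j, rfl⟩)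
    exact ⟨fun i => (this i).choose, fun i => (this i).choose_spec⟩
  obtain ⟨e, he⟩ : ∃ e, ∀ᶠ i in hyperfilter ℕ, d i = e :=
    Ultrafilter.eventually_exists_iff.1 (Eventually.of_forall fun j => ⟨d j, rfl⟩)
  have hlt : ∀ n : ℕ, ∀ᶠ j in hyperfilter ℕ, n < j := fun n =>
    Nat.hyperfilter_le_atTop (eventually_gt_atTop n)
  have hstep : ∀ n, ∃ j, n < j ∧ d j = e ∧ c n j = d n := fun n =>
    ((hlt n).and (he.and (hd n))).exists
  choose g hg using hstep
  have hs : ∀ i, g^[i + 1] 0 = g (g^[i] 0) := fun i => Function.iterate_succ_apply' g i 0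
  refine ⟨fun i => g^[i] 0, strictMono_nat_of_lt_succ fun i => ?_, rfl, e, fun i => ?_⟩
  · rw [hs]
    exact (hg _).1
  · dsimp only
    rw [hs (i + 1), (hg _).2.2, hs, (hg _).2.1]

variable {S : Type} (B : NBA S)

/-- The pairs of states joined by a path reading the letters of `w` from `i` to `j`, passing through
an accepting state if the flag is raised. -/
def blockType (w : ℕ → S) (i j : ℕ) : Set (Fin (B.n + 1) × Fin (B.n + 1) × Prop) :=
  {t | ∃ ρ : ℕ → Fin (B.n + 1), ρ i = t.1 ∧ ρ j = t.2.1 ∧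
    (∀ m, i ≤ m → m < j → B.trans (ρ m) (w m) (ρ (m + 1))) ∧
    (t.2.2 → ∃ m, i ≤ m ∧ m < j ∧ ρ m ∈ B.accept)}

/-- The words that can be cut into a block of type `t.1` followed by blocks of type `t.2`. -/
def cutSet (t : Set (Fin (B.n + 1) × Fin (B.n + 1) × Prop) ×
    Set (Fin (B.n + 1) × Fin (B.n + 1) × Prop)) : Set (ℕ → S) :=
  {w | ∃ ψ : ℕ → ℕ, StrictMono ψ ∧ ψ 0 = 0 ∧
    ∀ i, B.blockType w (ψ i) (ψ (i + 1)) = if i = 0 then t.1 else t.2}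

lemma iUnion_cutSet : ⋃ t, B.cutSet t = Set.univ := by
  refine Set.eq_univ_of_forall fun w => Set.mem_iUnion.2 ?_
  obtain ⟨ψ, h1, h2, e, he⟩ := exists_homogeneous_cuts (B.blockType w)
  refine ⟨(B.blockType w (ψ 0) (ψ 1), e), ψ, h1, h2, fun i => ?_⟩
  cases i with
  | zero => rfl
  | succ i => simpa using he i

lemma exists_lt_strictMono {ψ : ℕ → ℕ} (hψ : StrictMono ψ) (h0 : ψ 0 = 0) (m : ℕ) :
    ∃ i, ψ i ≤ m ∧ m < ψ (i + 1) := by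
  classical
  have hex : ∃ i, m < ψ (i + 1) := ⟨m, (hψ.id_le m).trans_lt (hψ (Nat.lt_succ_self m))⟩
  refine ⟨Nat.find hex, ?_, Nat.find_spec hex⟩
  rcases h : Nat.find hex with _ | i
  · omega
  · exact not_lt.1 (Nat.find_min hex (m := i) (by omega))

lemma mem_lang_of_mem_cutSet {t} {w w' : ℕ → S} (hw : w ∈ B.cutSet t) (hw' : w' ∈ B.cutSet t)
    (hL : w ∈ B.lang) : w' ∈ B.lang := by
  obtain ⟨ψ, hψ, hψ0, hψt⟩ := hw
  obtain ⟨ψ', hψ', hψ0', hψt'⟩ := hw'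
  obtain ⟨ρ, hρ0, hρt, hρa⟩ := hL
  have hblock : ∀ i, (ρ (ψ i), ρ (ψ (i + 1)),
      ∃ m, ψ i ≤ m ∧ m < ψ (i + 1) ∧ ρ m ∈ B.accept) ∈ B.blockType w' (ψ' i) (ψ' (i + 1)) := by
    intro i
    rw [hψt', ← hψt]
    exact ⟨ρ, rfl, rfl, fun m _ _ => hρt m, id⟩
  choose R hR1 hR2 hR3 hR4 using hblock
  choose idx hidx1 hidx2 using exists_lt_strictMono hψ' hψ0'
  have huniq : ∀ i m, ψ' i ≤ m → m < ψ' (i + 1) → idx m = i := by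
    intro i m h1 h2
    have h3 := hψ'.lt_iff_lt.1 ((hidx1 m).trans_lt h2)
    have h4 := hψ'.lt_iff_lt.1 (h1.trans_lt (hidx2 m))
    omega
  refine ⟨fun m => R (idx m) m, ?_, fun m => ?_, fun N => ?_⟩
  · have : idx 0 = 0 := huniq 0 0 hψ0'.le (hψ0'.ge.trans_lt (hψ' (Nat.lt_succ_self 0)))
    have h1 := hR1 0
    rw [hψ0'] at h1
    dsimp only at h1 ⊢
    rw [this, h1, hψ0]
    exact hρ0
  · have h1 := hR3 (idx m) m (hidx1 m) (hidx2 m)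
    dsimp only
    rcases (Nat.succ_le_of_lt (hidx2 m)).lt_or_eq with h | h
    · rw [huniq (idx m) (m + 1) ((hidx1 m).trans (Nat.le_succ m)) h]
      exact h1
    · have h2 : idx (m + 1) = idx m + 1 :=
        huniq _ _ h.ge (by rw [Nat.succ_eq_add_one] at h; rw [h]; exact hψ' (Nat.lt_succ_self _))
      have h3 := hR1 (idx m + 1)
      have h4 := hR2 (idx m)
      rw [← h] at h3 h4
      rw [h2]
      dsimp only at h3 h4
      rw [Nat.succ_eq_add_one] at h3 h4
      rw [h3, ← h4]
      exact h1
  · obtain ⟨m, hm, hma⟩ := hρa (ψ N)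
    obtain ⟨i, hi1, hi2⟩ := exists_lt_strictMono hψ hψ0 m
    obtain ⟨m', h1, h2, h3⟩ := hR4 i ⟨m, hi1, hi2, hma⟩
    refine ⟨m', ?_, ?_⟩
    · have := hψ.lt_iff_lt.1 (hm.trans_lt hi2)
      have := hψ'.id_le i
      simp only [id] at this
      omega
    · dsimp only
      rwa [huniq i m' h1 h2]

lemma eq_of_pre_eq {w w' : ℕ → S} {n m : ℕ} (h : Cyl.pre w n = Cyl.pre w' n) (hm : m < n) :
    w m = w' m := by
  have := Cyl.pre_eq_of_le (Nat.succ_le_of_lt hm) h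
  simp only [Cyl.pre, List.cons.injEq] at this
  exact this.1

lemma blockType_congr {w w' : ℕ → S} {i j : ℕ} (h : Cyl.pre w j = Cyl.pre w' j) :
    B.blockType w i j = B.blockType w' i j := by
  have key : ∀ {w w' : ℕ → S}, Cyl.pre w j = Cyl.pre w' j →
      B.blockType w i j ⊆ B.blockType w' i j := by
    rintro w w' h t ⟨ρ, h1, h2, h3, h4⟩
    refine ⟨ρ, h1, h2, fun m hi hj => ?_, h4⟩
    rw [← eq_of_pre_eq h hj]
    exact h3 m hi hj
  exact Set.Subset.antisymm (key h) (key h.symm)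

variable [Finite S] [MeasurableSpace S] [DiscreteMeasurableSpace S]

lemma analyticSet_cutSet [TopologicalSpace S] [DiscreteTopology S] (t) :
    AnalyticSet (B.cutSet t) := by
  have hmeas : ∀ i a b, MeasurableSet {w : ℕ → S | B.blockType w a b =
      if i = 0 then t.1 else t.2} := fun i a b => by
    refine Cyl.IsCylAt.measurableSet (n := b) fun w w' h hw => ?_
    simp only [Set.mem_ofPred_eq] at hw ⊢
    rw [← hw, B.blockType_congr h]
  let G : Set ((ℕ → S) × (ℕ → ℕ)) := {z | StrictMono z.2 ∧ z.2 0 = 0 ∧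
    ∀ i, B.blockType z.1 (z.2 i) (z.2 (i + 1)) = if i = 0 then t.1 else t.2}
  have hψ : ∀ i a, MeasurableSet {z : (ℕ → S) × (ℕ → ℕ) | z.2 i = a} := fun i a =>
    measurableSet_eq_fun ((measurable_pi_apply i).comp measurable_snd) measurable_const
  have hG : MeasurableSet G := by
    have e : G = (⋂ i, {z : (ℕ → S) × (ℕ → ℕ) | z.2 i < z.2 (i + 1)}) ∩
        {z : (ℕ → S) × (ℕ → ℕ) | z.2 0 = 0} ∩
        ⋂ i, ⋃ a, ⋃ b, {z : (ℕ → S) × (ℕ → ℕ) | z.2 i = a} ∩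
          {z : (ℕ → S) × (ℕ → ℕ) | z.2 (i + 1) = b} ∩
          Prod.fst ⁻¹' {w : ℕ → S | B.blockType w a b = if i = 0 then t.1 else t.2} := by
      ext ⟨w, ψ⟩
      simp only [G, Set.mem_ofPred_eq, Set.mem_inter_iff, Set.mem_iInter, Set.mem_iUnion,
        Set.mem_preimage]
      constructor
      · rintro ⟨h1, h2, h3⟩
        exact ⟨⟨fun i => h1 (Nat.lt_succ_self i), h2⟩, fun i => ⟨_, _, ⟨rfl, rfl⟩, h3 i⟩⟩
      · rintro ⟨⟨h1, h2⟩, h3⟩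
        refine ⟨strictMono_nat_of_lt_succ h1, h2, fun i => ?_⟩
        obtain ⟨a, b, ⟨rfl, rfl⟩, h⟩ := h3 i
        exact h
    rw [e]
    refine MeasurableSet.inter (MeasurableSet.inter (MeasurableSet.iInter fun i => ?_) (hψ 0 0))
      (MeasurableSet.iInter fun i => MeasurableSet.iUnion fun a => MeasurableSet.iUnion fun b =>
        ((hψ i a).inter (hψ (i + 1) b)).inter (measurable_fst (hmeas i a b)))
    exact measurableSet_lt ((measurable_pi_apply i).comp measurable_snd)
      ((measurable_pi_apply (i + 1)).comp measurable_snd)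
  have : B.cutSet t = Prod.fst '' G := by
    ext w
    simp only [cutSet, G, Set.mem_ofPred_eq, Set.mem_image, Prod.exists, exists_and_right,
      exists_eq_right]
  rw [this]
  exact hG.analyticSet_image measurable_fst

lemma measurableSet_lang : MeasurableSet B.lang := by
  let : TopologicalSpace S := ⊥
  have : DiscreteTopology S := ⟨rfl⟩
  have hu : ∀ P : Set (ℕ → S), (∀ t, ∀ w ∈ B.cutSet t, ∀ w' ∈ B.cutSet t, w ∈ P → w' ∈ P) →
      AnalyticSet P := by
    intro P hP
    have : P = ⋃ t : {t // (B.cutSet t ∩ P).Nonempty}, B.cutSet t.1 := by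
      ext w
      simp only [Set.mem_iUnion, Subtype.exists, exists_prop]
      constructor
      · intro hw
        have h : w ∈ ⋃ t, B.cutSet t := by rw [iUnion_cutSet]; trivial
        obtain ⟨t, ht⟩ := Set.mem_iUnion.1 h
        exact ⟨t, ⟨w, ht, hw⟩, ht⟩
      · rintro ⟨t, ⟨w', h1, h2⟩, h3⟩
        exact hP t w' h1 w h3 h2
    rw [this]
    exact AnalyticSet.iUnion fun t => B.analyticSet_cutSet t.1
  refine (hu _ fun t w hw w' hw' => B.mem_lang_of_mem_cutSet hw hw').measurableSet_of_compl
    (hu _ fun t w hw w' hw' h h' => h (B.mem_lang_of_mem_cutSet hw' hw h'))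

/-! ### Residuals -/

/-- The automaton with another set of initial states. -/
def withStart {S : Type} (B : NBA S) (R : Finset (Fin (B.n + 1))) : NBA S := { B with start := R }

open Classical in
/-- The states reachable by reading a letter. -/
noncomputable def next {S : Type} (B : NBA S) (R : Finset (Fin (B.n + 1))) (s : S) :
    Finset (Fin (B.n + 1)) :=
  Finset.univ.filter fun q => ∃ p ∈ R, B.trans p s q

lemma mem_next {S : Type} (B : NBA S) (R : Finset (Fin (B.n + 1))) (s : S) (q : Fin (B.n + 1)) :
    q ∈ B.next R s ↔ ∃ p ∈ R, B.trans p s q := by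
  simp [next]

lemma scons_mem_lang {S : Type} (B : NBA S) (R : Finset (Fin (B.n + 1))) (s : S) (w : ℕ → S) :
    Cyl.scons s w ∈ (B.withStart R).lang ↔ w ∈ (B.withStart (B.next R s)).lang := by
  constructor
  · rintro ⟨ρ, h0, h1, h2⟩
    refine ⟨fun n => ρ (n + 1), ?_, fun i => h1 (i + 1), fun N => ?_⟩
    · exact (B.mem_next R s _).2 ⟨ρ 0, h0, h1 0⟩
    · obtain ⟨m, hm, hma⟩ := h2 (N + 1)
      obtain ⟨m, rfl⟩ : ∃ k, m = k + 1 := ⟨m - 1, by omega⟩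
      exact ⟨m, by omega, hma⟩
  · rintro ⟨ρ, h0, h1, h2⟩
    obtain ⟨p, hp, hpt⟩ := (B.mem_next R s _).1 h0
    refine ⟨Cyl.scons p ρ, hp, fun i => ?_, fun N => ?_⟩
    · cases i with
      | zero => exact hpt
      | succ i => exact h1 i
    · obtain ⟨m, hm, hma⟩ := h2 N
      exact ⟨m + 1, by omega, hma⟩

end NBA

namespace MDP

open Cyl

variable {V A S : Type} [MeasurableSpace V] [MeasurableSpace A] [DiscreteMeasurableSpace V]
  [Finite S] {k : ℕ}

lemma measurableSet_label_lang (ℓ : V → S) (B : NBA S) :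
    MeasurableSet {ω : ℕ → V × A | (fun n => ℓ (ω n).1) ∈ B.lang} := by
  let : MeasurableSpace S := ⊤
  have : DiscreteMeasurableSpace S := ⟨fun _ => trivial⟩
  have : Measurable fun (ω : ℕ → V × A) (n : ℕ) => ℓ (ω n).1 :=
    measurable_pi_lambda _ fun n => (Measurable.of_discrete (f := ℓ)).comp
      (measurable_fst.comp (measurable_pi_apply n))
  exact this B.measurableSet_lang

/-- The events of satisfying exactly a given subfamily of a family of automata, tracked by the
subset construction. -/
noncomputable def patternTracked (A : Type) [MeasurableSpace A] (ℓ : V → S) (B : Fin k → NBA S)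
    (c : Fin k → Prop) : Tracked A (fun (x : ∀ i, Finset (Fin ((B i).n + 1))) (v : V) i =>
      (B i).next (x i) (ℓ v)) where
  ev x := {ω | ∀ i, (fun n => ℓ (ω n).1) ∈ ((B i).withStart (x i)).lang ↔ c i}
  measurableSet_ev x := by
    simp only [Set.ofPred_forall]
    refine MeasurableSet.iInter fun i => ?_
    by_cases h : c i
    · simp only [h, iff_true]
      exact measurableSet_label_lang ℓ _
    · simp only [h, iff_false]
      exact (measurableSet_label_lang ℓ _).compl
  tl_ev x e := by
    ext ω
    simp only [tl, Set.mem_ofPred_eq]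
    refine forall_congr' fun i => ?_
    rw [← NBA.scons_mem_lang]
    have : (fun n => ℓ (scons e ω n).1) = scons (ℓ e.1) fun n => ℓ (ω n).1 := by
      ext n
      cases n <;> rfl
    rw [this]

lemma existsUnique_mem_patternTracked (ℓ : V → S) (B : Fin k → NBA S)
    (x : ∀ i, Finset (Fin ((B i).n + 1))) (ω : ℕ → V × A) :
    ∃! c, ω ∈ (patternTracked A ℓ B c).ev x :=
  ⟨fun i => (fun n => ℓ (ω n).1) ∈ ((B i).withStart (x i)).lang, fun _ => Iff.rfl,
    fun _ hc => funext fun i => propext (hc i).symm⟩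

end MDP

/-! ### Polytopes and their Pareto curves -/

namespace Polytope

section Cone

variable {ι E : Type*} [AddCommGroup E] [Module ℝ E]

/-- Conic combinations can be taken over a linearly independent subfamily. -/
lemma exists_linearIndepOn_conic (t : ι → E) (s : Finset ι) (c : ι → ℝ)
    (hc : ∀ i ∈ s, 0 ≤ c i) :
    ∃ (s' : Finset ι) (c' : ι → ℝ), LinearIndepOn ℝ t (s' : Set ι) ∧ (∀ i ∈ s', 0 ≤ c' i) ∧
      ∑ i ∈ s', c' i • t i = ∑ i ∈ s, c i • t i := by
  classical
  induction h : s.card using Nat.strong_induction_on generalizing s c with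
  | _ n ih =>
    by_cases hs : LinearIndepOn ℝ t (s : Set ι)
    · exact ⟨s, c, hs, hc, rfl⟩
    obtain ⟨g, hg0, i, his, hgi⟩ : ∃ g : ι → ℝ, ∑ i ∈ s, g i • t i = 0 ∧ ∃ i ∈ s, 0 < g i := by
      rw [linearIndepOn_finset_iff] at hs
      push Not at hs
      obtain ⟨g, h1, i, hi, h2⟩ := hs
      rcases h2.lt_or_gt with h2 | h2
      · exact ⟨fun i => -g i, by simp [h1], i, hi, by linarith⟩
      · exact ⟨g, h1, i, hi, h2⟩
    obtain ⟨j, hj, hmin⟩ := (s.filter fun i => 0 < g i).exists_min_image (fun i => c i / g i)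
      ⟨i, by simp [his, hgi]⟩
    simp only [Finset.mem_filter] at hj hmin
    set q := c j / g j with hq
    have hq0 : 0 ≤ q := div_nonneg (hc j hj.1) hj.2.le
    have hcard : (s.erase j).card < n := by
      rw [← h]
      exact Finset.card_erase_lt_of_mem hj.1
    obtain ⟨s', c', h1, h2, h3⟩ := ih _ hcard (s.erase j) (fun i => c i - q * g i)
      (fun i hi => by
        have his := Finset.mem_of_mem_erase hi
        rcases lt_or_ge 0 (g i) with hgi | hgi
        · have := (le_div_iff₀ hgi).1 (hmin i ⟨his, hgi⟩)
          linarith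
        · have := mul_nonpos_of_nonneg_of_nonpos hq0 hgi
          have := hc i his
          linarith) rfl
    refine ⟨s', c', h1, h2, h3.trans ?_⟩
    have hj0 : c j - q * g j = 0 := by
      rw [hq, div_mul_cancel₀ _ hj.2.ne', sub_self]
    have h4 := Finset.add_sum_erase s (fun i => (c i - q * g i) • t i) hj.1
    rw [hj0, zero_smul, zero_add] at h4
    rw [h4]
    simp only [sub_smul, Finset.sum_sub_distrib, mul_smul, ← Finset.smul_sum, hg0, smul_zero,
      sub_zero]

lemma isClosed_conic [Fintype ι] [TopologicalSpace E] [IsTopologicalAddGroup E]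
    [ContinuousSMul ℝ E] [T2Space E] (t : ι → E) :
    IsClosed {x | ∃ c : ι → ℝ, (∀ i, 0 ≤ c i) ∧ ∑ i, c i • t i = x} := by
  classical
  have e : {x | ∃ c : ι → ℝ, (∀ i, 0 ≤ c i) ∧ ∑ i, c i • t i = x} =
      ⋃ s : {s : Finset ι // LinearIndepOn ℝ t (s : Set ι)},
        Fintype.linearCombination ℝ (fun i : (s.1 : Set ι) => t i) '' {c | ∀ i, 0 ≤ c i} := by
    ext x
    simp only [Set.mem_ofPred_eq, Set.mem_iUnion, Set.mem_image, Fintype.linearCombination_apply]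
    constructor
    · rintro ⟨c, hc, rfl⟩
      obtain ⟨s, c', h1, h2, h3⟩ := exists_linearIndepOn_conic t Finset.univ c fun i _ => hc i
      refine ⟨⟨s, h1⟩, fun i => c' i, fun i => h2 i i.2, ?_⟩
      rw [← h3]
      exact Finset.sum_coe_sort s fun i => c' i • t i
    · rintro ⟨⟨s, hs⟩, c, hc, rfl⟩
      refine ⟨fun i => if h : i ∈ s then c ⟨i, h⟩ else 0, fun i => ?_, ?_⟩
      · dsimp only
        split_ifs with h
        exacts [hc _, le_rfl]
      · rw [← Finset.sum_subset (Finset.subset_univ s) fun i _ hi => by simp [hi],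
          ← Finset.sum_coe_sort s]
        refine Finset.sum_congr rfl fun i _ => ?_
        simp only [i.2, dite_true]
        rfl
  rw [e]
  refine isClosed_iUnion_of_finite fun s => ?_
  refine (LinearMap.isClosedEmbedding_of_injective (LinearMap.ker_eq_bot.2
    (LinearIndependent.fintypeLinearCombination_injective s.2))).isClosedMap _ ?_
  simp only [Set.ofPred_forall]
  exact isClosed_iInter fun i => isClosed_le continuous_const (continuous_apply i)

end Cone

variable {k : ℕ}

lemma exists_weights (g : StrongDual ℝ (Fin k → ℝ)) (x : Fin k → ℝ) :
    g x = ∑ i, g (Pi.single i 1) * x i := by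
  conv_lhs => rw [pi_eq_sum_univ x]
  rw [map_sum]
  refine Finset.sum_congr rfl fun i _ => ?_
  rw [map_smul, smul_eq_mul, mul_comm]
  congr 2
  ext j
  simp [Pi.single_apply, eq_comm]

/-- The points below some point of a set of nonnegative vectors form a polytope, if finitely many
points of the set maximize all the nonnegative weightings. -/
theorem eq_convexHull_of_finite_optimal {Z F U : Set (Fin k → ℝ)} (hF : F.Finite) (hFZ : F ⊆ Z)
    (hZ0 : ∀ z ∈ Z, 0 ≤ z) (hU : U = {r | 0 ≤ r ∧ ∃ z ∈ Z, r ≤ z}) (hconv : Convex ℝ U)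
    (hopt : ∀ w : Fin k → ℝ, (∀ i, 0 ≤ w i) → ∃ f ∈ F, ∀ z ∈ Z, ∑ i, w i * z i ≤ ∑ i, w i * f i) :
    ∃ P : Finset (Fin k → ℝ), U = convexHull ℝ ↑P := by
  classical
  let cut : (Fin k → ℝ) → Finset (Fin k) → Fin k → ℝ := fun f s i => if i ∈ s then f i else 0
  have hP : (Set.image2 cut F Set.univ).Finite := hF.image2 _ Set.finite_univ
  refine ⟨hP.toFinset, Set.Subset.antisymm (fun r hr => ?_) ?_⟩
  · by_contra hn
    rw [hU] at hr
    obtain ⟨hr0, z, hz, hrz⟩ := hr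
    rw [hP.coe_toFinset] at hn
    obtain ⟨g, u, hgu, hur⟩ := geometric_hahn_banach_closed_point (convex_convexHull ℝ _)
      (hP.isClosed_convexHull ℝ) hn
    set w : Fin k → ℝ := fun i => g (Pi.single i 1) with hw
    obtain ⟨f, hf, hmax⟩ := hopt (fun i => max (w i) 0) fun i => le_max_right _ _
    have h1 := hgu _ (subset_convexHull ℝ _
      ⟨f, hf, Finset.univ.filter fun i => 0 < w i, Set.mem_univ _, rfl⟩)
    rw [exists_weights] at h1 hur
    have h2 : ∑ i, w i * cut f (Finset.univ.filter fun i => 0 < w i) i =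
        ∑ i, max (w i) 0 * f i := by
      refine Finset.sum_congr rfl fun i _ => ?_
      by_cases h : 0 < w i
      · simp [cut, h, h.le]
      · simp [cut, h, not_lt.1 h]
    have h3 : ∑ i, w i * r i ≤ ∑ i, max (w i) 0 * z i := Finset.sum_le_sum fun i _ =>
      (mul_le_mul_of_nonneg_right (le_max_left _ _) (hr0 i)).trans
        (mul_le_mul_of_nonneg_left (hrz i) (le_max_right _ _))
    have h4 := hmax z hz
    rw [← h2] at h4
    linarith
  · refine convexHull_min ?_ hconv
    rw [hP.coe_toFinset, hU]
    rintro _ ⟨f, hf, s, -, rfl⟩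
    have hf0 := hZ0 f (hFZ hf)
    refine ⟨fun i => ?_, f, hFZ hf, fun i => ?_⟩ <;> simp only [cut] <;> split_ifs
    exacts [hf0 i, le_rfl, le_rfl, hf0 i]

/-- A Pareto optimal point of a polytope maximizes a positive weighting. -/
lemma exists_pos_weights_of_pareto (P : Finset (Fin k → ℝ)) {r : Fin k → ℝ}
    (hpar : ¬ ∃ r' ∈ convexHull ℝ (P : Set (Fin k → ℝ)), r ≤ r' ∧ r ≠ r') :
    ∃ W : Fin k → ℝ, (∀ i, 0 < W i) ∧ ∀ p ∈ P, ∑ i, W i * p i ≤ ∑ i, W i * r i := by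
  let K : Set (Fin k → ℝ) := {x | ∃ c : P → ℝ, (∀ p, 0 ≤ c p) ∧ ∑ p, c p • (p.1 - r) = x}
  have hKcl : IsClosed K := isClosed_conic fun p : P => p.1 - r
  have hKconv : Convex ℝ K := by
    rintro _ ⟨c, hc, rfl⟩ _ ⟨c', hc', rfl⟩ a b ha hb -
    refine ⟨fun p => a * c p + b * c' p, fun p => by have := hc p; have := hc' p; positivity, ?_⟩
    simp only [add_smul, Finset.sum_add_distrib, Finset.smul_sum, mul_smul]
  have hdisj : Disjoint (stdSimplex ℝ (Fin k)) K := by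
    rw [Set.disjoint_left]
    rintro x ⟨hx0, hx1⟩ ⟨c, hc, hcx⟩
    have hxne : x ≠ 0 := by
      rintro rfl
      simp at hx1
    set s := ∑ p, c p with hs
    have hs0 : 0 < s := by
      refine (Finset.sum_nonneg fun p _ => hc p).lt_of_ne fun h => hxne ?_
      have := (Finset.sum_eq_zero_iff_of_nonneg fun p _ => hc p).1 h.symm
      rw [← hcx]
      exact Finset.sum_eq_zero fun p hp => by rw [this p hp, zero_smul]
    have hmem : ∑ p : P, (c p / s) • p.1 ∈ convexHull ℝ (P : Set (Fin k → ℝ)) :=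
      (convex_convexHull ℝ _).sum_mem (fun p _ => div_nonneg (hc p) hs0.le)
        (by rw [← Finset.sum_div, div_self hs0.ne']) fun p _ => subset_convexHull ℝ _ p.2
    have heq : ∑ p : P, (c p / s) • p.1 = r + s⁻¹ • x := by
      rw [← hcx]
      simp only [smul_sub, Finset.sum_sub_distrib, ← Finset.sum_smul, ← hs]
      simp only [Finset.smul_sum, smul_smul, inv_mul_cancel₀ hs0.ne', one_smul, div_eq_inv_mul]
      abel
    refine hpar ⟨_, hmem, ?_, ?_⟩
    · rw [heq]
      intro i
      have := hx0 i
      simp only [Pi.add_apply, Pi.smul_apply, smul_eq_mul]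
      have : 0 ≤ s⁻¹ * x i := by positivity
      linarith
    · rw [heq]
      intro h
      have := left_eq_add.1 h
      rw [smul_eq_zero] at this
      exact this.elim (inv_ne_zero hs0.ne') hxne
  obtain ⟨g, u, v, h1, h2, h3⟩ := geometric_hahn_banach_compact_closed (convex_stdSimplex ℝ _)
    (isCompact_stdSimplex ℝ (Fin k)) hKconv hKcl hdisj
  have hv0 : v < 0 := by
    have := h3 0 ⟨0, fun _ => le_rfl, by simp⟩
    rwa [map_zero] at this
  refine ⟨fun i => -g (Pi.single i 1), fun i => ?_, fun p hp => ?_⟩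
  · have := h1 _ (single_mem_stdSimplex ℝ i)
    linarith
  · have hg : 0 ≤ g (p - r) := by
      by_contra! hneg
      have := h3 ((v / g (p - r)) • (p - r)) ⟨Pi.single ⟨p, hp⟩ (v / g (p - r)), fun q => ?_, ?_⟩
      · rw [map_smul, smul_eq_mul, div_mul_cancel₀ _ hneg.ne] at this
        exact lt_irrefl _ this
      · by_cases h : q = ⟨p, hp⟩
        · subst h
          simpa using div_nonneg_of_nonpos hv0.le hneg.le
        · simp [h]
      · rw [Finset.sum_eq_single ⟨p, hp⟩ (fun q _ hq => by simp [hq]) (by simp)]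
        simp
    rw [map_sub, exists_weights, exists_weights g r] at hg
    simp only [neg_mul, Finset.sum_neg_distrib]
    linarith

/-- The Pareto curve of a polytope is a finite union of faces exposed by positive weights. -/
theorem pareto_eq_iUnion_faces (P : Finset (Fin k → ℝ)) :
    ∃ (m : ℕ) (Ws : Fin m → Fin k → ℝ), (∀ j i, 0 < Ws j i) ∧
      {r ∈ convexHull ℝ (P : Set (Fin k → ℝ)) |
        ¬ ∃ r' ∈ convexHull ℝ (P : Set (Fin k → ℝ)), r ≤ r' ∧ r ≠ r'} =
      ⋃ j : Fin m, {r ∈ convexHull ℝ (P : Set (Fin k → ℝ)) |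
        ∀ x ∈ convexHull ℝ (P : Set (Fin k → ℝ)), ∑ i, Ws j i * x i ≤ ∑ i, Ws j i * r i} := by
  classical
  let mx : (Fin k → ℝ) → Finset (Fin k → ℝ) := fun W =>
    P.filter fun p => ∀ p' ∈ P, ∑ i, W i * p' i ≤ ∑ i, W i * p i
  let Q := {Q : P.powerset // ∃ W : Fin k → ℝ, (∀ i, 0 < W i) ∧ mx W = Q.1}
  obtain ⟨m, ⟨e⟩⟩ := Finite.exists_equiv_fin Q
  let Ws : Fin m → Fin k → ℝ := fun j => (e.symm j).2.choose
  have hWs : ∀ j, (∀ i, 0 < Ws j i) ∧ mx (Ws j) = (e.symm j).1.1 := fun j =>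
    (e.symm j).2.choose_spec
  refine ⟨m, Ws, fun j => (hWs j).1, ?_⟩
  ext r
  simp only [Set.mem_ofPred_eq, Set.mem_iUnion]
  constructor
  · rintro ⟨hr, hpar⟩
    obtain ⟨W, hW, hWr⟩ := exists_pos_weights_of_pareto P hpar
    let q : Q := ⟨⟨mx W, Finset.mem_powerset.2 (Finset.filter_subset _ _)⟩, W, hW, rfl⟩
    refine ⟨e q, hr, fun x hx => ?_⟩
    have hq : mx (Ws (e q)) = mx W := by rw [(hWs _).2, e.symm_apply_apply]
    set W' := Ws (e q)
    have hlin : ∀ W : Fin k → ℝ, IsLinearMap ℝ fun x : Fin k → ℝ => ∑ i, W i * x i := fun W =>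
      ⟨fun x y => by simp [mul_add, Finset.sum_add_distrib], fun c x => by
        simp only [Pi.smul_apply, smul_eq_mul, Finset.mul_sum]
        exact Finset.sum_congr rfl fun i _ => by ring⟩
    have hne : P.Nonempty := by
      rw [Finset.nonempty_iff_ne_empty]
      rintro rfl
      simp at hr
    obtain ⟨p0, hp0, hmax⟩ := P.exists_max_image (fun p => ∑ i, W' i * p i) hne
    have hx' : ∑ i, W' i * x i ≤ ∑ i, W' i * p0 i :=
      convexHull_min (s := (P : Set (Fin k → ℝ)))
        (t := {x | ∑ i, W' i * x i ≤ ∑ i, W' i * p0 i}) (fun p hp => hmax p hp)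
        (convex_halfSpace_le (hlin W') _) hx
    refine hx'.trans ?_
    rw [Finset.mem_convexHull'] at hr
    obtain ⟨c, hc0, hc1, rfl⟩ := hr
    have hval : ∀ W : Fin k → ℝ, ∑ i, W i * (∑ p ∈ P, c p • p) i =
        ∑ p ∈ P, c p * ∑ i, W i * p i := by
      intro W
      simp only [Finset.sum_apply, Pi.smul_apply, smul_eq_mul, Finset.mul_sum]
      rw [Finset.sum_comm]
      exact Finset.sum_congr rfl fun p _ => Finset.sum_congr rfl fun i _ => by ring
    have hsupp : ∀ p ∈ P, c p ≠ 0 → p ∈ mx W := by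
      intro p hp hcp
      have h1 : ∑ p' ∈ P, c p' * ((∑ i, W i * (∑ p ∈ P, c p • p) i) - ∑ i, W i * p' i) = 0 := by
        simp only [mul_sub, Finset.sum_sub_distrib, ← Finset.sum_mul, hc1, one_mul]
        rw [hval, sub_self]
      have h2 := (Finset.sum_eq_zero_iff_of_nonneg fun p' hp' =>
        mul_nonneg (hc0 p' hp') (sub_nonneg.2 (hWr p' hp'))).1 h1 p hp
      have h3 := (mul_eq_zero.1 h2).resolve_left hcp
      refine Finset.mem_filter.2 ⟨hp, fun p' hp' => (hWr p' hp').trans ?_⟩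
      linarith
    rw [hval, ← one_mul (∑ i, W' i * p0 i), ← hc1, Finset.sum_mul]
    refine Finset.sum_le_sum fun p hp => ?_
    by_cases hcp : c p = 0
    · simp [hcp]
    · have := hsupp p hp hcp
      rw [← hq] at this
      exact mul_le_mul_of_nonneg_left ((Finset.mem_filter.1 this).2 p0 hp0) (hc0 p hp)
  · rintro ⟨j, hr, hmax⟩
    refine ⟨hr, ?_⟩
    rintro ⟨r', hr', hle, hne⟩
    obtain ⟨i, hi⟩ := Function.ne_iff.1 hne
    refine (hmax r' hr').not_gt (Finset.sum_lt_sum (fun i _ =>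
      mul_le_mul_of_nonneg_left (hle i) ((hWs j).1 i).le) ⟨i, Finset.mem_univ i, ?_⟩)
    exact mul_lt_mul_of_pos_left ((hle i).lt_of_ne hi) ((hWs j).1 i)

end Polytope

/-! ### The achievable set -/

namespace MDP

section Achievable

variable {V A S : Type} [Fintype V] [Fintype A] [Nonempty V] [Nonempty A] [DecidableEq V]
  [MeasurableSpace V] [DiscreteMeasurableSpace V] [MeasurableSpace A] [DiscreteMeasurableSpace A]
  [Finite S] {M : MDP V A} {k : ℕ}

lemma PrOmega_eq_prob (σ : M.Strategy) (u : V) (ℓ : V → S) (B : NBA S) :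
    M.PrOmega σ u ℓ B.lang = prob σ u {ω | (fun n => ℓ (ω n).1) ∈ B.lang} := by
  let : MeasurableSpace S := ⊤
  have : DiscreteMeasurableSpace S := ⟨fun _ => trivial⟩
  have hm : Measurable fun (w : ℕ → V) (n : ℕ) => ℓ (w n) :=
    measurable_pi_lambda _ fun n => (Measurable.of_discrete (f := ℓ)).comp (measurable_pi_apply n)
  exact PrEvent_eq_law M σ u (hm B.measurableSet_lang)

open Classical in
lemma prob_label_lang_eq_sum [Fintype (Fin k → Prop)] (σ : M.Strategy) (u : V) (ℓ : V → S)
    (B : Fin k → NBA S) (i : Fin k) :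
    prob σ u {ω | (fun n => ℓ (ω n).1) ∈ (B i).lang} = ∑ c : Fin k → Prop,
      if c i then prob σ u ((patternTracked A ℓ B c).ev fun i => (B i).start) else 0 := by
  have hO := existsUnique_mem_patternTracked (A := A) ℓ B fun i => (B i).start
  rw [← Finset.sum_filter]
  have h := measureReal_biUnion_finset (μ := M.law σ u)
    (s := Finset.univ.filter fun c : Fin k → Prop => c i)
    (fun c _ c' _ hne => Set.disjoint_left.2 fun ω h h' => hne ((hO ω).unique h h'))
    fun c _ => (patternTracked A ℓ B c).measurableSet_ev fun i => (B i).start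
  simp only [prob]
  rw [← h]
  congr 1
  ext ω
  simp only [Set.mem_ofPred_eq, Set.mem_iUnion, Finset.mem_filter, Finset.mem_univ, true_and,
    exists_prop]
  constructor
  · intro hi
    obtain ⟨c, hc, -⟩ := hO ω
    exact ⟨c, (hc i).1 hi, hc⟩
  · rintro ⟨c, hci, hc⟩
    exact (hc i).2 hci

lemma exists_finite_optimal_PrOmega (M : MDP V A) (ℓ : V → S) (u : V) (B : Fin k → NBA S) :
    ∃ T : Set M.Strategy, T.Finite ∧ ∀ w : Fin k → ℝ, (∀ i, 0 ≤ w i) → ∃ τ ∈ T, ∀ σ : M.Strategy,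
      ∑ i, w i * M.PrOmega σ u ℓ (B i).lang ≤ ∑ i, w i * M.PrOmega τ u ℓ (B i).lang := by
  classical
  let : Fintype (Fin k → Prop) := Fintype.ofFinite _
  obtain ⟨T, hT, -, hopt⟩ := exists_finite_optimal M (patternTracked A ℓ B)
    (existsUnique_mem_patternTracked ℓ B) u fun i => (B i).start
  refine ⟨T, hT, fun w hw => ?_⟩
  have key : ∀ σ : M.Strategy, ∑ i, w i * M.PrOmega σ u ℓ (B i).lang =
      wval (patternTracked A ℓ B) (fun c => ∑ i, if c i then w i else 0) σ u
        fun i => (B i).start := by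
    intro σ
    simp only [PrOmega_eq_prob, prob_label_lang_eq_sum, wval, Finset.mul_sum, Finset.sum_mul]
    rw [Finset.sum_comm]
    simp only [mul_ite, ite_mul, mul_zero, zero_mul]
  simp only [key]
  exact hopt _ fun c => Finset.sum_nonneg fun i _ => by split_ifs <;> simp [hw i]

lemma achOmega_eq (M : MDP V A) (ℓ : V → S) (u : V) (B : Fin k → NBA S) :
    M.achOmega ℓ u (fun i => (B i).lang) = {r | 0 ≤ r ∧
      ∃ z ∈ Set.range fun (σ : M.Strategy) i => M.PrOmega σ u ℓ (B i).lang, r ≤ z} := by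
  ext r
  simp only [achOmega, Set.mem_ofPred_eq, Set.exists_range_iff]
  constructor
  · rintro ⟨h, σ, hσ⟩
    exact ⟨fun i => (h i).1, σ, hσ⟩
  · rintro ⟨h, σ, hσ⟩
    refine ⟨fun i => ⟨h i, (hσ i).trans ?_⟩, σ, hσ⟩
    dsimp only
    rw [PrOmega_eq_prob]
    exact prob_le_one _ _ _

lemma convex_achOmega (M : MDP V A) (ℓ : V → S) (u : V) (B : Fin k → NBA S) :
    Convex ℝ (M.achOmega ℓ u fun i => (B i).lang) := by
  rw [achOmega_eq]
  rintro r ⟨hr, _, ⟨σ, rfl⟩, hσ⟩ s ⟨hs, _, ⟨τ, rfl⟩, hτ⟩ a b ha hb hab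
  refine ⟨fun i => ?_, _, ⟨σ.mix τ a b ha hb, rfl⟩, fun i => ?_⟩
  · have := hr i
    have := hs i
    simp only [Pi.zero_apply, Pi.add_apply, Pi.smul_apply, smul_eq_mul] at *
    positivity
  · have h1 := hσ i
    have h2 := hτ i
    simp only [PrOmega_eq_prob] at h1 h2 ⊢
    rw [prob_mix σ τ ha hb hab]
    exact add_le_add (mul_le_mul_of_nonneg_left h1 ha) (mul_le_mul_of_nonneg_left h2 hb)

theorem exists_achOmega_eq_convexHull (M : MDP V A) (ℓ : V → S) (u : V) (B : Fin k → NBA S) :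
    ∃ P : Finset (Fin k → ℝ), M.achOmega ℓ u (fun i => (B i).lang) = convexHull ℝ ↑P := by
  obtain ⟨T, hT, hopt⟩ := exists_finite_optimal_PrOmega M ℓ u B
  refine Polytope.eq_convexHull_of_finite_optimal (hT.image _) (Set.image_subset_range _ T) ?_
    (achOmega_eq M ℓ u B) (convex_achOmega M ℓ u B) fun w hw => ?_
  · rintro _ ⟨σ, rfl⟩ i
    simp only [PrOmega_eq_prob]
    exact prob_nonneg _ _ _
  · obtain ⟨τ, hτ, h⟩ := hopt w hw
    refine ⟨_, ⟨τ, hτ, rfl⟩, ?_⟩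
    rintro _ ⟨σ, rfl⟩
    exact h σ

end Achievable

end MDP

open MDP in
/-- For a finite labeled MDP `M`, a state `u`, and ω-regular properties
`φ_1, …, φ_k`, the achievable set
`U = {r ∈ [0,1]^k : ∃σ, Pr^σ_u(φ_i) ≥ r_i for all i}` is a closed convex polytope
(the convex hull of finitely many points), downward closed within the nonnegative
orthant; in particular its Pareto curve is a convex polyhedral surface (a finite
union of faces of `U`, each cut out by a strictly positive weight vector). -/
theorem omega_regular_achievable_set_is_polytope
    {V A S : Type} [Fintype V] [Fintype A] [Fintype S]
    [Nonempty V] [Nonempty A] [DecidableEq V]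
    (M : MDP V A) (ℓ : V → S) (u : V) {k : ℕ}
    (L : Fin k → Set (ℕ → S)) (hL : ∀ i, IsOmegaRegular (L i)) :
    (∃ P : Finset (Fin k → ℝ), M.achOmega ℓ u L = convexHull ℝ ↑P) ∧
    IsClosed (M.achOmega ℓ u L) ∧
    Convex ℝ (M.achOmega ℓ u L) ∧
    (∀ r ∈ M.achOmega ℓ u L, ∀ r' : Fin k → ℝ,
      (∀ i, 0 ≤ r' i) → r' ≤ r → r' ∈ M.achOmega ℓ u L) ∧
    (∃ (m : ℕ) (Ws : Fin m → Fin k → ℝ), (∀ j i, 0 < Ws j i) ∧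
      {r ∈ M.achOmega ℓ u L | ¬ ∃ r' ∈ M.achOmega ℓ u L, r ≤ r' ∧ r ≠ r'} =
        ⋃ j : Fin m, {r ∈ M.achOmega ℓ u L |
          ∀ x ∈ M.achOmega ℓ u L, ∑ i, Ws j i * x i ≤ ∑ i, Ws j i * r i}) := by
  choose B hB using hL
  obtain rfl : (fun i => (B i).lang) = L := funext hB
  let : MeasurableSpace V := ⊤
  have : DiscreteMeasurableSpace V := ⟨fun _ => trivial⟩
  let : MeasurableSpace A := ⊤
  have : DiscreteMeasurableSpace A := ⟨fun _ => trivial⟩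
  obtain ⟨P, hP⟩ := exists_achOmega_eq_convexHull M ℓ u B
  refine ⟨⟨P, hP⟩, ?_, convex_achOmega M ℓ u B, ?_, ?_⟩
  · rw [hP]
    exact P.finite_toSet.isClosed_convexHull ℝ
  · rintro r ⟨hr, σ, hσ⟩ r' h0 hle
    exact ⟨fun i => ⟨h0 i, (hle i).trans (hr i).2⟩, σ, fun i => (hle i).trans (hσ i)⟩
  · rw [hP]
    exact Polytope.pareto_eq_iUnion_faces P
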